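/- arXiv:1205.6671 — 4 statements merged into one kernel-verified Lean document; each statement's English description precedes it below -/
import Mathlib

section
/- Let the proper nonzero homogeneous ideal I of P possess a finite Pommaret basis for the reverse lexicographic order (i.e., the variables are δ-regular for I and revlex). Then the satiety of I equals the satiety of its leading ideal: sat(I) = sat(lt(I)). -/
open MvPolynomial

/-- The (0-based) class of a nonzero exponent vector: the smallest index with
nonzero entry.  (The variables `x_1, …, x_n` of the paper are `X 0, …, X (n-1)`.) -/
noncomputable def cls {n : ℕ} (μ : Fin n →₀ ℕ) : ℕ :=
  sInf {i : ℕ | ∃ hi : i < n, μ ⟨i, hi⟩ ≠ 0}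

/-- `x^μ` involutively divides `x^ν` : it divides it and the quotient only involves
the multiplicative variables `x_1, …, x_{cls μ}` of `x^μ`. -/
def InvDiv {n : ℕ} (μ ν : Fin n →₀ ℕ) : Prop :=
  μ ≤ ν ∧ ∀ j : Fin n, ν j ≠ μ j → (j : ℕ) ≤ cls μ

/-- The exponent of the leading term of `f` with respect to the monomial order `m`. -/
noncomputable def ldeg {n : ℕ} {K : Type*} [Field K] (m : MonomialOrder (Fin n))
    (f : MvPolynomial (Fin n) K) : Fin n →₀ ℕ :=
  m.toSyn.symm (f.support.sup fun μ => m.toSyn μ)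

/-- The leading ideal `lt(I)` of an ideal `I` with respect to `m`. -/
noncomputable def ltIdeal {n : ℕ} {K : Type*} [Field K] (m : MonomialOrder (Fin n))
    (I : Ideal (MvPolynomial (Fin n) K)) : Ideal (MvPolynomial (Fin n) K) :=
  Ideal.span {g | ∃ f ∈ I, f ≠ 0 ∧ g = monomial (ldeg m f) (1 : K)}

/-- `H` is a (finite, monomial) Pommaret basis of the monomial ideal `I`:
it generates `I` and every monomial of `I` has a unique involutive divisor in `H`. -/
def IsMonPB {n : ℕ} {K : Type*} [Field K] (H : Set (Fin n →₀ ℕ))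
    (I : Ideal (MvPolynomial (Fin n) K)) : Prop :=
  H.Finite ∧ I = Ideal.span ((fun μ => monomial μ (1 : K)) '' H) ∧
    ∀ ν : Fin n →₀ ℕ, monomial ν (1 : K) ∈ I → ∃! μ, μ ∈ H ∧ InvDiv μ ν

/-- `H` is a Pommaret basis of the polynomial ideal `I` w.r.t. the monomial order `m`:
its elements lie in `I`, are nonzero with pairwise distinct leading terms, and the
leading terms form a Pommaret basis of the leading ideal. -/
def IsPB {n : ℕ} {K : Type*} [Field K] (m : MonomialOrder (Fin n))
    (H : Finset (MvPolynomial (Fin n) K)) (I : Ideal (MvPolynomial (Fin n) K)) : Prop :=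
  (∀ h ∈ H, h ∈ I) ∧ (∀ h ∈ H, h ≠ 0) ∧
    Set.InjOn (fun h : MvPolynomial (Fin n) K => ldeg m h) ↑H ∧
    IsMonPB ((fun h : MvPolynomial (Fin n) K => ldeg m h) '' ↑H) (ltIdeal m I)

/-- `m` is the degree reverse lexicographic order (with the reversed conventions of the
paper: for equal degrees, `μ ≺ ν` iff the first nonvanishing entry of `μ - ν` is positive). -/
def IsRevLex {n : ℕ} (m : MonomialOrder (Fin n)) : Prop :=
  ∀ μ ν : Fin n →₀ ℕ, m.toSyn μ < m.toSyn ν ↔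
    ((μ.sum fun _ e => e) < (ν.sum fun _ e => e) ∨
      ((μ.sum fun _ e => e) = (ν.sum fun _ e => e) ∧
        ∃ i : Fin n, ν i < μ i ∧ ∀ j : Fin n, j < i → μ j = ν j))

/-- `I` is a homogeneous ideal. -/
def IsHomIdeal {n : ℕ} {K : Type*} [Field K] (I : Ideal (MvPolynomial (Fin n) K)) : Prop :=
  ∃ S : Set (MvPolynomial (Fin n) K), (∀ f ∈ S, ∃ d, f.IsHomogeneous d) ∧ I = Ideal.span S

/-- The homogeneous maximal ideal `⟨x_1, …, x_n⟩`. -/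
noncomputable def mxI (n : ℕ) (K : Type*) [Field K] : Ideal (MvPolynomial (Fin n) K) :=
  Ideal.span (Set.range X)

/-- The saturation `I : ⟨x_1,…,x_n⟩^∞` of `I`, as a set. -/
def satSet {n : ℕ} {K : Type*} [Field K] (I : Ideal (MvPolynomial (Fin n) K)) :
    Set (MvPolynomial (Fin n) K) :=
  {f | ∃ s : ℕ, ∀ g ∈ (mxI n K ^ s : Ideal (MvPolynomial (Fin n) K)), g * f ∈ I}

/-- The satiety of `I`: the smallest degree from which on the homogeneous components of
`I` and `I^sat` coincide. -/
noncomputable def satiety {n : ℕ} {K : Type*} [Field K]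
    (I : Ideal (MvPolynomial (Fin n) K)) : ℕ :=
  sInf {q : ℕ | ∀ p : ℕ, q ≤ p → ∀ f : MvPolynomial (Fin n) K,
    f.IsHomogeneous p → (f ∈ satSet I ↔ f ∈ I)}

theorem ldeg_eq {n : ℕ} {K : Type*} [Field K] (m : MonomialOrder (Fin n))
    (f : MvPolynomial (Fin n) K) : ldeg m f = m.degree f := rfl

theorem mem_ltIdeal_iff {n : ℕ} {K : Type*} [Field K] (m : MonomialOrder (Fin n))
    (I : Ideal (MvPolynomial (Fin n) K)) (g : MvPolynomial (Fin n) K) :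
    g ∈ ltIdeal m I ↔ ∀ ν ∈ g.support, ∃ f ∈ I, f ≠ 0 ∧ m.degree f ≤ ν := by
  have h : {g | ∃ f ∈ I, f ≠ 0 ∧ g = monomial (ldeg m f) (1 : K)}
      = (fun s => monomial s (1 : K)) '' {s | ∃ f ∈ I, f ≠ 0 ∧ s = m.degree f} := by
    ext g
    constructor
    · rintro ⟨f, hf, h0, rfl⟩
      exact ⟨_, ⟨f, hf, h0, rfl⟩, rfl⟩
    · rintro ⟨_, ⟨f, hf, h0, rfl⟩, rfl⟩
      exact ⟨f, hf, h0, rfl⟩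
  unfold ltIdeal
  rw [h, mem_ideal_span_monomial_image]
  constructor
  · intro H ν hν
    obtain ⟨_, ⟨f, hf, h0, rfl⟩, hle⟩ := H ν hν
    exact ⟨f, hf, h0, hle⟩
  · intro H ν hν
    obtain ⟨f, hf, h0, hle⟩ := H ν hν
    exact ⟨_, ⟨f, hf, h0, rfl⟩, hle⟩

theorem monomial_mem_ltIdeal_iff {n : ℕ} {K : Type*} [Field K] (m : MonomialOrder (Fin n))
    (I : Ideal (MvPolynomial (Fin n) K)) (ν : Fin n →₀ ℕ) :
    monomial ν (1 : K) ∈ ltIdeal m I ↔ ∃ f ∈ I, f ≠ 0 ∧ m.degree f ≤ ν := by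
  classical
  rw [mem_ltIdeal_iff]
  simp [support_monomial]

theorem mem_ltIdeal_iff' {n : ℕ} {K : Type*} [Field K] (m : MonomialOrder (Fin n))
    (I : Ideal (MvPolynomial (Fin n) K)) (g : MvPolynomial (Fin n) K) :
    g ∈ ltIdeal m I ↔ ∀ ν ∈ g.support, monomial ν (1 : K) ∈ ltIdeal m I := by
  rw [mem_ltIdeal_iff]
  simp only [monomial_mem_ltIdeal_iff]

theorem homComp_mem {n : ℕ} {K : Type*} [Field K]
    {I : Ideal (MvPolynomial (Fin n) K)} (hI : IsHomIdeal I) (d : ℕ)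
    {f : MvPolynomial (Fin n) K} (hf : f ∈ I) : homogeneousComponent d f ∈ I := by
  obtain ⟨S, hS, rfl⟩ := hI
  let _ : GradedAlgebra (homogeneousSubmodule (Fin n) K) := MvPolynomial.gradedAlgebra
  have h := Ideal.homogeneous_span (homogeneousSubmodule (Fin n) K) S (by
    intro x hx
    obtain ⟨d, hd⟩ := hS x hx
    exact ⟨d, hd⟩)
  exact homogeneousComponent_mem_of_mem h hf d

/-- A monomial of the leading ideal is the leading monomial of a homogeneous element. -/
theorem exists_lead {n : ℕ} {K : Type*} [Field K] (m : MonomialOrder (Fin n))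
    {I : Ideal (MvPolynomial (Fin n) K)} (hI : IsHomIdeal I) {ν : Fin n →₀ ℕ}
    (hν : monomial ν (1 : K) ∈ ltIdeal m I) :
    ∃ h ∈ I, h.IsHomogeneous ν.degree ∧ coeff ν h ≠ 0 ∧
      ∀ μ ∈ h.support, m.toSyn μ ≤ m.toSyn ν := by
  classical
  rw [monomial_mem_ltIdeal_iff] at hν
  obtain ⟨f, hf, h0, hle⟩ := hν
  have hF : m.degree (monomial (ν - m.degree f) (1 : K) * f) = ν := by
    rw [m.degree_mul (by simp) h0, m.degree_monomial]
    simp [tsub_add_cancel_of_le hle]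
  have hF0 : monomial (ν - m.degree f) (1 : K) * f ≠ 0 := mul_ne_zero (by simp) h0
  refine ⟨homogeneousComponent ν.degree (monomial (ν - m.degree f) (1 : K) * f),
    homComp_mem hI _ (I.mul_mem_left _ hf), homogeneousComponent_isHomogeneous _ _, ?_, ?_⟩
  · rw [coeff_homogeneousComponent, if_pos rfl]
    have h7 := m.coeff_degree_ne_zero_iff.mpr hF0
    rwa [hF] at h7
  · intro μ hμ
    rw [mem_support_iff, coeff_homogeneousComponent] at hμ
    have : coeff μ (monomial (ν - m.degree f) (1 : K) * f) ≠ 0 := by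
      intro h
      simp [h] at hμ
    have := m.le_degree (mem_support_iff.mpr this)
    rwa [hF] at this

theorem reduce_mem {n : ℕ} {K : Type*} [Field K] (m : MonomialOrder (Fin n))
    {I : Ideal (MvPolynomial (Fin n) K)} (hI : IsHomIdeal I) (p : ℕ)
    (V : MvPolynomial (Fin n) K → Prop)
    (hV : ∀ f h, V f → h ∈ I → V (f - h))
    (hlead : ∀ f, V f → f.IsHomogeneous p → f ≠ 0 → monomial (m.degree f) (1 : K) ∈ ltIdeal m I)
    (f : MvPolynomial (Fin n) K) (hf : V f) (hp : f.IsHomogeneous p) : f ∈ I := by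
  classical
  induction hs : m.toSyn (m.degree f) using WellFoundedLT.induction generalizing f with
  | ind s ih =>
  subst hs
  by_cases h0 : f = 0
  · rw [h0]; exact I.zero_mem
  obtain ⟨h, hhI, hhom, hc, hsup⟩ := exists_lead m hI (hlead f hf hp h0)
  set ν := m.degree f with hνdef
  have hνf : coeff ν f ≠ 0 := m.coeff_degree_ne_zero_iff.mpr h0
  have hdeg : ν.degree = p := by
    by_contra hne
    exact hνf (hp.coeff_eq_zero hne)
  rw [hdeg] at hhom
  set c := coeff ν f / coeff ν h with hcdef
  have hmem : C c * h ∈ I := I.mul_mem_left _ hhI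
  have hsub : f - C c * h ∈ I := by
    by_cases h1 : f - C c * h = 0
    · rw [h1]; exact I.zero_mem
    refine ih _ ?_ (f - C c * h) (hV _ _ hf hmem) (hp.sub (hhom.C_mul c)) rfl
    have hd := m.degree_mem_support h1
    rw [mem_support_iff] at hd
    refine lt_of_le_of_ne ?_ ?_
    · by_cases h2 : coeff (m.degree (f - C c * h)) f = 0
      · refine hsup _ ?_
        rw [mem_support_iff]
        intro h3
        apply hd
        rw [coeff_sub, coeff_C_mul, h2, h3]; simp
      · exact m.le_degree (mem_support_iff.mpr h2)
    · intro heq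
      have heq := m.toSyn.injective heq
      apply hd
      rw [heq, coeff_sub, coeff_C_mul, hcdef]
      field_simp
      simp
  have := I.add_mem hsub hmem
  simpa using this

theorem satSet_sub {n : ℕ} {K : Type*} [Field K] {I : Ideal (MvPolynomial (Fin n) K)}
    (f h : MvPolynomial (Fin n) K) (hf : f ∈ satSet I) (hh : h ∈ I) : f - h ∈ satSet I := by
  obtain ⟨s, hs⟩ := hf
  refine ⟨s, fun g hg => ?_⟩
  rw [mul_sub]
  exact I.sub_mem (hs g hg) (I.mul_mem_left _ hh)

theorem subset_satSet {n : ℕ} {K : Type*} [Field K] {I : Ideal (MvPolynomial (Fin n) K)}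
    {f : MvPolynomial (Fin n) K} (hf : f ∈ I) : f ∈ satSet I :=
  ⟨0, fun _ _ => I.mul_mem_left _ hf⟩

theorem mxI_pow_eq (n : ℕ) (K : Type*) [Field K] (s : ℕ) :
    mxI n K ^ s = Ideal.span ((fun a => monomial a (1 : K)) '' {a | a.degree = s}) :=
  pow_idealOfVars_eq_span s

theorem mem_satSet_iff {n : ℕ} {K : Type*} [Field K] {I : Ideal (MvPolynomial (Fin n) K)}
    {f : MvPolynomial (Fin n) K} : f ∈ satSet I ↔
      ∃ s : ℕ, ∀ a : Fin n →₀ ℕ, a.degree = s → monomial a (1 : K) * f ∈ I := by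
  constructor
  · rintro ⟨s, hs⟩
    refine ⟨s, fun a ha => hs _ ?_⟩
    rw [mxI_pow_eq]
    exact Ideal.subset_span ⟨a, ha, rfl⟩
  · rintro ⟨s, hs⟩
    refine ⟨s, fun g hg => ?_⟩
    rw [mxI_pow_eq] at hg
    induction hg using Submodule.span_induction with
    | mem x hx =>
      obtain ⟨a, ha, rfl⟩ := hx
      exact hs a ha
    | zero => simp
    | add x y _ _ hx hy => rw [add_mul]; exact I.add_mem hx hy
    | smul c x _ hx => rw [smul_eq_mul, mul_assoc]; exact I.mul_mem_left _ hx

theorem sat_dir1 {n : ℕ} {K : Type*} [Field K] (m : MonomialOrder (Fin n))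
    {I : Ideal (MvPolynomial (Fin n) K)} (hI : IsHomIdeal I) (p : ℕ)
    (hL : ∀ f : MvPolynomial (Fin n) K, f.IsHomogeneous p →
      f ∈ satSet (ltIdeal m I) → f ∈ ltIdeal m I)
    (f : MvPolynomial (Fin n) K) (hp : f.IsHomogeneous p) (hf : f ∈ satSet I) : f ∈ I := by
  classical
  refine reduce_mem m hI p (fun f => f ∈ satSet I) (fun f h => satSet_sub f h) ?_ f hf hp
  intro f hf hp h0
  have hdeg : (m.degree f).degree = p := by
    by_contra hne
    exact m.coeff_degree_ne_zero_iff.mpr h0 (hp.coeff_eq_zero hne)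
  refine hL _ (isHomogeneous_monomial _ hdeg) ?_
  rw [mem_satSet_iff] at hf ⊢
  obtain ⟨s, hs⟩ := hf
  refine ⟨s, fun a ha => ?_⟩
  rw [monomial_mul, one_mul, monomial_mem_ltIdeal_iff]
  refine ⟨_, hs a ha, mul_ne_zero (by simp) h0, ?_⟩
  rw [m.degree_mul (by simp) h0, m.degree_monomial]
  simp

theorem cls_zero_of {n : ℕ} (i₀ : Fin n) (h0 : (i₀ : ℕ) = 0) (μ : Fin n →₀ ℕ)
    (h : μ i₀ ≠ 0) : cls μ = 0 := by
  unfold cls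
  refine Nat.sInf_eq_zero.mpr (Or.inl ⟨?_, ?_⟩)
  · rw [← h0]; exact i₀.2
  · convert h using 2
    exact Fin.ext h0.symm

theorem X_cancel {n : ℕ} {K : Type*} [Field K] (m : MonomialOrder (Fin n))
    {I : Ideal (MvPolynomial (Fin n) K)} (hI : IsHomIdeal I)
    (i₀ : Fin n) (h0 : (i₀ : ℕ) = 0) (M : Set (Fin n →₀ ℕ)) (D : ℕ)
    (hD : ∀ μ ∈ M, μ.degree ≤ D) (hM : IsMonPB M (ltIdeal m I))
    (d : ℕ) (hd : D ≤ d) (f : MvPolynomial (Fin n) K) (hf : f.IsHomogeneous d)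
    (hX : X i₀ * f ∈ I) : f ∈ I := by
  classical
  refine reduce_mem m hI d (fun f => X i₀ * f ∈ I) ?_ ?_ f hX hf
  · intro f h hf hh
    simp only [mul_sub]
    exact I.sub_mem hf (I.mul_mem_left _ hh)
  intro f hX hp hf0
  have hdeg : (m.degree f).degree = d := by
    by_contra hne
    exact m.coeff_degree_ne_zero_iff.mpr hf0 (hp.coeff_eq_zero hne)
  have hin : monomial (Finsupp.single i₀ 1 + m.degree f) (1 : K) ∈ ltIdeal m I := by
    rw [monomial_mem_ltIdeal_iff]
    refine ⟨_, hX, mul_ne_zero (X_ne_zero _) hf0, ?_⟩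
    rw [m.degree_mul (X_ne_zero _) hf0, m.degree_X]
  obtain ⟨_, hspan, huniq⟩ := hM
  obtain ⟨μ, ⟨hμM, hle, hinv⟩, -⟩ := huniq _ hin
  have hμν : μ ≤ m.degree f := by
    have hne : ∀ j, j ≠ i₀ → (Finsupp.single i₀ 1 + m.degree f : Fin n →₀ ℕ) j = m.degree f j := by
      intro j hj
      simp [Ne.symm hj]
    have hi : (Finsupp.single i₀ 1 + m.degree f : Fin n →₀ ℕ) i₀ = 1 + m.degree f i₀ := by
      simp
    have hcase : μ i₀ ≤ m.degree f i₀ := by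
      by_contra hlt
      push Not at hlt
      have hμ0 : μ i₀ ≠ 0 := by omega
      have hc := cls_zero_of i₀ h0 μ hμ0
      have heq : μ = Finsupp.single i₀ 1 + m.degree f := by
        ext j
        by_cases hj : j = i₀
        · subst hj
          have := hle j
          omega
        · by_contra hne'
          have := hinv j (Ne.symm hne')
          rw [hc] at this
          exact hj (Fin.ext (by omega))
      have := hD μ hμM
      rw [heq, map_add, Finsupp.degree_single, hdeg] at this
      omega
    intro j
    by_cases hj : j = i₀
    · rw [hj]; exact hcase
    · rw [← hne j hj]; exact hle j
  have h1 : monomial μ (1 : K) ∈ ltIdeal m I := by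
    rw [hspan]
    exact Ideal.subset_span ⟨μ, hμM, rfl⟩
  rw [monomial_mem_ltIdeal_iff] at h1 ⊢
  obtain ⟨g, hg, hg0, hgle⟩ := h1
  exact ⟨g, hg, hg0, hgle.trans hμν⟩

theorem sat_of_X_pow {n : ℕ} {K : Type*} [Field K] (m : MonomialOrder (Fin n))
    {I : Ideal (MvPolynomial (Fin n) K)} (hI : IsHomIdeal I)
    (i₀ : Fin n) (h0 : (i₀ : ℕ) = 0) (M : Set (Fin n →₀ ℕ)) (hM : IsMonPB M (ltIdeal m I))
    (p s : ℕ) (f : MvPolynomial (Fin n) K) (hf : f.IsHomogeneous p)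
    (hX : X i₀ ^ s * f ∈ I) : f ∈ satSet I := by
  obtain ⟨D, hD⟩ : ∃ D, ∀ μ ∈ M, μ.degree ≤ D := by
    obtain ⟨D, hD⟩ := (hM.1.image (fun μ => μ.degree)).bddAbove
    exact ⟨D, fun μ hμ => hD ⟨μ, hμ, rfl⟩⟩
  have key : ∀ (s d : ℕ), D ≤ d → ∀ g : MvPolynomial (Fin n) K, g.IsHomogeneous d →
      X i₀ ^ s * g ∈ I → g ∈ I := by
    intro s
    induction s with
    | zero => intro d _ g _ hg; simpa using hg
    | succ s ih =>
      intro d hd g hg hXg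
      refine X_cancel m hI i₀ h0 M D hD hM d hd g hg ?_
      refine ih (1 + d) (by omega) _ ((isHomogeneous_X K i₀).mul hg) ?_
      rwa [← mul_assoc, ← pow_succ]
  rw [mem_satSet_iff]
  refine ⟨D, fun a ha => ?_⟩
  refine key s (D + p) (by omega) _ ((isHomogeneous_monomial _ ha).mul hf) ?_
  rw [mul_left_comm]
  exact I.mul_mem_left _ hX

theorem sat_dir2 {n : ℕ} {K : Type*} [Field K] (m : MonomialOrder (Fin n))
    (hrev : IsRevLex m)
    {I : Ideal (MvPolynomial (Fin n) K)} (hI : IsHomIdeal I)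
    (i₀ : Fin n) (h0 : (i₀ : ℕ) = 0) (M : Set (Fin n →₀ ℕ)) (hM : IsMonPB M (ltIdeal m I))
    (p : ℕ)
    (hIp : ∀ f : MvPolynomial (Fin n) K, f.IsHomogeneous p → f ∈ satSet I → f ∈ I)
    (f : MvPolynomial (Fin n) K) (hp : f.IsHomogeneous p) (hf : f ∈ satSet (ltIdeal m I)) :
    f ∈ ltIdeal m I := by
  classical
  rw [mem_ltIdeal_iff']
  intro ν hν
  have hνp : ν.degree = p := by
    by_contra hne
    exact mem_support_iff.mp hν (hp.coeff_eq_zero hne)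
  rw [mem_satSet_iff] at hf
  obtain ⟨s, hs⟩ := hf
  set e : Fin n →₀ ℕ := Finsupp.single i₀ s with he
  have h1 := hs e (by simp [he])
  rw [mem_ltIdeal_iff'] at h1
  have h2 := h1 (e + ν) (by
    rw [mem_support_iff, coeff_monomial_mul, one_mul]
    exact mem_support_iff.mp hν)
  obtain ⟨h, hhI, hhom, hc, hsup⟩ := exists_lead m hI h2
  have hle : ∀ μ ∈ h.support, e ≤ μ := by
    intro μ hμ
    rw [he, Finsupp.single_le_iff]
    by_contra hlt
    push Not at hlt
    have hμd : μ.degree = (e + ν).degree := by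
      by_contra hne
      exact mem_support_iff.mp hμ (hhom.coeff_eq_zero hne)
    refine absurd (hsup μ hμ) (not_le.mpr ?_)
    rw [hrev]
    refine Or.inr ⟨hμd.symm, i₀, ?_, ?_⟩
    · rw [he]; simp; omega
    · intro j hj
      have : (j : ℕ) < i₀ := hj
      omega
  have hfac : monomial e (1 : K) * (h.divMonomial e) = h := by
    have h3 := divMonomial_add_modMonomial h e
    have h4 : h.modMonomial e = 0 := by
      ext μ
      by_cases hμ : e ≤ μ
      · rw [coeff_modMonomial_of_le _ hμ]; simp
      · rw [coeff_modMonomial_of_not_le _ hμ, coeff_zero]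
        by_contra hne
        exact hμ (hle μ (mem_support_iff.mpr hne))
    rw [h4, add_zero] at h3
    exact h3
  set g := h.divMonomial e with hg
  have hcg : ∀ μ, coeff μ g = coeff (e + μ) h := fun μ => coeff_divMonomial e h μ
  have hghom : g.IsHomogeneous p := by
    have : ∀ μ, coeff μ g ≠ 0 → μ.degree = p := by
      intro μ hμ
      rw [hcg] at hμ
      have : (e + μ).degree = (e + ν).degree := by
        by_contra hne
        exact hμ (hhom.coeff_eq_zero hne)
      rw [map_add, map_add] at this
      omega
    intro μ hμ
    rw [← this μ hμ, Finsupp.degree_eq_weight_one]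
    rfl
  have hgI : g ∈ I := by
    refine hIp g hghom (sat_of_X_pow m hI i₀ h0 M hM p s g hghom ?_)
    rw [X_pow_eq_monomial, ← he, hfac]
    exact hhI
  rw [monomial_mem_ltIdeal_iff]
  have hgν : coeff ν g ≠ 0 := by rw [hcg]; exact hc
  have hg0 : g ≠ 0 := by
    intro h; rw [h] at hgν; simp at hgν
  refine ⟨g, hgI, hg0, le_of_eq ?_⟩
  apply m.toSyn.injective
  refine le_antisymm ?_ (m.le_degree (mem_support_iff.mpr hgν))
  have h5 := m.degree_mem_support hg0
  rw [mem_support_iff, hcg, ← mem_support_iff] at h5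
  have h6 := hsup _ h5
  rw [map_add, map_add] at h6
  exact le_of_add_le_add_left h6

/-- Thm. 4.4 (ii): in δ-regular variables for revlex,
`sat I = sat (lt I)`. -/
theorem statement15 {n : ℕ} {K : Type*} [Field K] (m : MonomialOrder (Fin n))
    (hrev : IsRevLex m)
    (I : Ideal (MvPolynomial (Fin n) K)) (hI0 : I ≠ ⊥) (hIT : I ≠ ⊤) (hIhom : IsHomIdeal I)
    (H : Finset (MvPolynomial (Fin n) K)) (hPB : IsPB m H I) :
    satiety I = satiety (ltIdeal m I) := by
  have hn : 0 < n := by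
    rcases Nat.eq_zero_or_pos n with hn | hn
    · exfalso
      subst hn
      obtain ⟨f, hf, hf0⟩ := Submodule.exists_mem_ne_zero_of_ne_bot hI0
      rw [eq_C_of_isEmpty f] at hf hf0
      refine hIT (Ideal.eq_top_of_isUnit_mem _ hf ?_)
      refine IsUnit.map C (isUnit_iff_ne_zero.mpr ?_)
      intro h
      rw [h] at hf0
      simp at hf0
    · exact hn
  unfold satiety
  congr 1
  ext q
  simp only [Set.mem_ofPred_eq]
  refine forall_congr' fun p => forall_congr' fun _ => ?_
  constructor
  · intro h f hf
    exact ⟨sat_dir2 m hrev hIhom ⟨0, hn⟩ rfl _ hPB.2.2.2 p (fun f hf => (h f hf).1) f hf,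
      subset_satSet⟩
  · intro h f hf
    exact ⟨sat_dir1 m hIhom p (fun f hf => (h f hf).1) f hf, subset_satSet⟩
end

section
/- Let the proper nonzero homogeneous ideal I of P possess a finite Pommaret basis for the reverse lexicographic order (i.e., the variables are δ-regular for I and revlex). Then the projective dimension of I as a P-module equals the projective dimension of the leading ideal: pd(I) = pd(lt(I)); both equal n − d, where d is the minimal class of an element of the Pommaret basis of I. -/
open MvPolynomial

open CategoryTheory in
/-- The projective dimension of a module: the minimal length of a projective resolution. -/
noncomputable def projDim {R : Type} [CommRing R] (M : ModuleCat R) : ℕ :=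
  sInf {d : ℕ | ∃ pr : ProjectiveResolution M,
    ∀ i : ℕ, d < i → Limits.IsZero (pr.complex.X i)}

namespace Pom
open CategoryTheory Abelian

lemma hasPD_of_resolution {R : Type} [CommRing R] (M : ModuleCat.{0} R) (d : ℕ)
    (pr : ProjectiveResolution M) (h : ∀ i : ℕ, d < i → Limits.IsZero (pr.complex.X i)) :
    HasProjectiveDimensionLE M d := by
  refine HasProjectiveDimensionLT.mk ?_
  intro i hi Y e
  obtain ⟨f, hf, rfl⟩ := pr.extMk_surjective e (i + 1) rfl
  have : f = 0 := (h i hi).eq_of_src _ _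
  subst this
  exact pr.extMk_zero _ _

set_option maxHeartbeats 1000000 in
lemma spliceAux {R : Type} [CommRing R] (S : ShortComplex (ModuleCat.{0} R)) (hS : S.ShortExact)
    (h2 : Projective S.X₂) (d : ℕ) (C : ChainComplex (ModuleCat.{0} R) ℕ)
    (hC : ∀ n, Projective (C.X n)) (p : C.X 0 ⟶ S.X₁) [Epi p] (hp : C.d 1 0 ≫ p = 0)
    (hex : (ShortComplex.mk _ _ hp).Exact)
    (hsucc : ∀ n, (ShortComplex.mk _ _ (C.d_comp_d (n + 2) (n + 1) n)).Exact)
    (h : ∀ i : ℕ, d < i → Limits.IsZero (C.X i)) :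
    ∃ pr : ProjectiveResolution S.X₃, ∀ i : ℕ, d + 1 < i → Limits.IsZero (pr.complex.X i) := by
  have := hS.mono_f
  have := hS.epi_g
  have hw : C.d 1 0 ≫ (p ≫ S.f) = 0 := by
    rw [← Category.assoc, hp, Limits.zero_comp]
  have hw1 : (p ≫ S.f) ≫ S.g = 0 := by
    rw [Category.assoc, S.zero, Limits.comp_zero]
  have hw2 : (C.augment (p ≫ S.f) hw).d 1 0 ≫ S.g = 0 := hw1
  have ex0 : (ShortComplex.mk (p ≫ S.f) S.g hw1).Exact := by
    let φ : ShortComplex.mk (p ≫ S.f) S.g hw1 ⟶ S :=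
      { τ₁ := p, τ₂ := 𝟙 _, τ₃ := 𝟙 _ }
    have : Epi φ.τ₁ := ‹Epi p›
    have : IsIso φ.τ₂ := inferInstanceAs (IsIso (𝟙 _))
    have : Mono φ.τ₃ := inferInstanceAs (Mono (𝟙 _))
    exact (ShortComplex.exact_iff_of_epi_of_isIso_of_mono φ).2 hS.exact
  have ex1 : (ShortComplex.mk _ _ hw).Exact := by
    let φ : ShortComplex.mk _ _ hp ⟶ ShortComplex.mk _ _ hw :=
      { τ₁ := 𝟙 _, τ₂ := 𝟙 _, τ₃ := S.f }
    have : Epi φ.τ₁ := inferInstanceAs (Epi (𝟙 _))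
    have : IsIso φ.τ₂ := inferInstanceAs (IsIso (𝟙 _))
    have : Mono φ.τ₃ := ‹Mono S.f›
    exact (ShortComplex.exact_iff_of_epi_of_isIso_of_mono φ).1 hex
  refine ⟨{ complex := C.augment (p ≫ S.f) hw
            projective := ?_
            π := (ChainComplex.toSingle₀Equiv _ _).symm ⟨S.g, hw2⟩
            quasiIso := ⟨fun n => ?_⟩ }, ?_⟩
  · rintro (_ | n)
    · exact h2
    · exact hC n
  · rcases n with _ | n
    · rw [ChainComplex.quasiIsoAt₀_iff, ShortComplex.quasiIso_iff_of_zeros']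
      · refine (ShortComplex.exact_and_epi_g_iff_of_iso ?_).2 ⟨ex0, ‹Epi S.g›⟩
        refine ShortComplex.isoMk (Iso.refl _) (Iso.refl _) (Iso.refl _) ?_ ?_
        · dsimp; erw [Category.id_comp]
        · dsimp; erw [Category.id_comp]
      all_goals rfl
    · rw [quasiIsoAt_iff_exactAt']
      · rw [HomologicalComplex.exactAt_iff' _ (n + 1 + 1) (n + 1) n (by simp) (by simp)]
        rcases n with _ | n
        · exact ex1
        · exact hsucc n
      · apply ChainComplex.exactAt_succ_single_obj
  · rintro (_ | i) hi
    · omega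
    · exact h i (by omega)

lemma splice {R : Type} [CommRing R] (S : ShortComplex (ModuleCat.{0} R)) (hS : S.ShortExact)
    (h2 : Projective S.X₂) (d : ℕ) (pr : ProjectiveResolution S.X₁)
    (h : ∀ i : ℕ, d < i → Limits.IsZero (pr.complex.X i)) :
    ∃ pr : ProjectiveResolution S.X₃, ∀ i : ℕ, d + 1 < i → Limits.IsZero (pr.complex.X i) :=
  have hpi : Epi (pr.π.f 0) := inferInstance
  @spliceAux R _ S hS h2 d pr.complex pr.projective (pr.π.f 0) hpi pr.complex_d_comp_π_f_zero
    pr.exact₀ pr.exact_succ h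

lemma resolution_of_hasPD {R : Type} [CommRing R] (d : ℕ) (M : ModuleCat.{0} R)
    (h : HasProjectiveDimensionLE M d) :
    ∃ pr : ProjectiveResolution M, ∀ i : ℕ, d < i → Limits.IsZero (pr.complex.X i) := by
  induction d generalizing M with
  | zero =>
    have : Projective M := (projective_iff_hasProjectiveDimensionLE_zero _).2 h
    refine ⟨ProjectiveResolution.self M, ?_⟩
    intro i hi
    exact HomologicalComplex.isZero_single_obj_X _ _ _ _ (by omega)
  | succ d ih =>
    have hS := M.shortExact_projectiveShortComplex
    obtain ⟨pr, hpr⟩ := ih _ ((hS.hasProjectiveDimensionLT_X₃_iff d inferInstance).1 h)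
    exact splice _ hS inferInstance d pr hpr

lemma projDim_eq {R : Type} [CommRing R] (M : ModuleCat.{0} R) (d : ℕ)
    (h : HasProjectiveDimensionLE M d) (h' : 0 < d → ¬ HasProjectiveDimensionLT M d) :
    projDim M = d := by
  refine IsLeast.csInf_eq ⟨resolution_of_hasPD d M h, ?_⟩
  rintro e ⟨pr, hpr⟩
  by_contra! hlt
  have := hasPD_of_resolution M e pr hpr
  exact h' (by omega) (hasProjectiveDimensionLT_of_ge M (e + 1) d (by omega))
end Pom
namespace Pom
open CategoryTheory Abelian TensorProduct
open scoped Polynomial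

section
variable {A M : Type} [CommRing A] [AddCommGroup M] [Module A M] [Module A[X] M]
  [IsScalarTower A A[X] M]

noncomputable def phi0 (A M : Type) [CommRing A] [AddCommGroup M] [Module A M] [Module A[X] M]
    [IsScalarTower A A[X] M] : M →ₗ[A] A[X] ⊗[A] M where
  toFun m := (Polynomial.X : A[X]) ⊗ₜ[A] m - (1 : A[X]) ⊗ₜ[A] ((Polynomial.X : A[X]) • m)
  map_add' a b := by simp only [tmul_add, smul_add]; abel
  map_smul' r m := by
    simp only [tmul_smul, RingHom.id_apply, smul_sub]
    rw [smul_comm (Polynomial.X : A[X]) r m, tmul_smul]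

noncomputable def phi (A M : Type) [CommRing A] [AddCommGroup M] [Module A M] [Module A[X] M]
    [IsScalarTower A A[X] M] : A[X] ⊗[A] M →ₗ[A[X]] A[X] ⊗[A] M :=
  (phi0 A M).liftBaseChange A[X]

noncomputable def eps (A M : Type) [CommRing A] [AddCommGroup M] [Module A M] [Module A[X] M]
    [IsScalarTower A A[X] M] : A[X] ⊗[A] M →ₗ[A[X]] M :=
  (LinearMap.id : M →ₗ[A] M).liftBaseChange A[X]

lemma phi_tmul (p : A[X]) (m : M) :
    phi A M (p ⊗ₜ m) = (p * Polynomial.X) ⊗ₜ m - p ⊗ₜ ((Polynomial.X : A[X]) • m) := by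
  simp [phi, phi0, smul_sub, smul_tmul']

lemma eps_tmul (p : A[X]) (m : M) : eps A M (p ⊗ₜ m) = p • m := by
  simp [eps]

lemma sub_mem (p : A[X]) (m : M) :
    p ⊗ₜ[A] m - (1 : A[X]) ⊗ₜ[A] (p • m) ∈ LinearMap.range (phi A M) := by
  induction p using Polynomial.induction_on' generalizing m with
  | add p q hp hq =>
    have := add_mem (hp m) (hq m)
    convert this using 1
    rw [add_tmul, add_smul, tmul_add]; abel
  | monomial i a =>
    have : ∀ (i : ℕ) (m : M), (Polynomial.X ^ i : A[X]) ⊗ₜ[A] m - (1 : A[X]) ⊗ₜ[A] ((Polynomial.X ^ i : A[X]) • m)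
        ∈ LinearMap.range (phi A M) := by
      intro i
      induction i with
      | zero => intro m; simp
      | succ i ih =>
        intro m
        have h1 := ih ((Polynomial.X : A[X]) • m)
        have h2 : phi A M ((Polynomial.X ^ i : A[X]) ⊗ₜ m) ∈ LinearMap.range (phi A M) := ⟨_, rfl⟩
        rw [phi_tmul] at h2
        have := add_mem h1 h2
        convert this using 1
        rw [pow_succ, mul_smul]; abel
    have h := (LinearMap.range (phi A M)).smul_mem (Polynomial.C a) (this i m)
    convert h using 1
    rw [smul_sub, smul_tmul', smul_tmul', smul_eq_mul, smul_eq_mul, mul_one,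
      Polynomial.C_mul_X_pow_eq_monomial, ← Polynomial.C_mul_X_pow_eq_monomial, mul_smul, ← Polynomial.algebraMap_eq,
      algebraMap_smul, tmul_smul, smul_tmul', Algebra.algebraMap_eq_smul_one]

lemma phi_inj : Function.Injective (phi A M) := by
  rw [injective_iff_map_eq_zero]
  intro t ht
  let e := PolynomialModule.polynomialTensorProductLEquivPolynomialModule A M
  have key : ∀ (t : A[X] ⊗[A] M) (i : ℕ), (e (phi A M t)).coeff (i + 1) =
      (e t).coeff i - (Polynomial.X : A[X]) • (e t).coeff (i + 1) := by
    intro t i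
    induction t using TensorProduct.induction_on with
    | zero => simp
    | add a b ha hb =>
      simp only [map_add, PolynomialModule.coeff_add, Finsupp.add_apply, ha, hb, smul_add]; abel
    | tmul p m =>
      have he : ∀ (p : A[X]) (m : M) (j : ℕ), (e (p ⊗ₜ m)).coeff j = p.coeff j • m := by
        intro p m j
        have : e (p ⊗ₜ m) = p • PolynomialModule.single A 0 m := rfl
        rw [this, PolynomialModule.smul_single_apply]
        simp
      rw [phi_tmul, map_sub, he, he]
      have : (e ((p * Polynomial.X) ⊗ₜ[A] m) - e (p ⊗ₜ[A] ((Polynomial.X : A[X]) • m))).coeff (i + 1)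
        = (e ((p * Polynomial.X) ⊗ₜ[A] m)).coeff (i + 1) - (e (p ⊗ₜ[A] ((Polynomial.X : A[X]) • m))).coeff (i + 1) := rfl
      rw [this, he, he, Polynomial.coeff_mul_X, smul_comm]
  have h1 : ∀ i, (e t).coeff i = (Polynomial.X : A[X]) • (e t).coeff (i + 1) := by
    intro i
    have := key t i
    rw [ht, map_zero] at this
    exact sub_eq_zero.1 this.symm
  have h2 : ∀ k i, (e t).coeff (i + k) = 0 → (e t).coeff i = 0 := by
    intro k
    induction k with
    | zero => simp
    | succ k ih => intro i h; exact ih i (by rw [h1, add_assoc, h, smul_zero])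
  apply e.injective
  rw [map_zero]
  apply PolynomialModule.coeff_injective
  ext i
  obtain ⟨N, hN⟩ : ∃ N, ∀ j ∈ (e t).coeff.support, j ≤ N :=
    ⟨(e t).coeff.support.sup id, fun j hj => Finset.le_sup (f := id) hj⟩
  refine h2 (N + 1) i ?_
  by_contra hne
  have := hN _ (Finsupp.mem_support_iff.2 hne)
  omega

lemma eps_exact : Function.Exact (phi A M) (eps A M) := by
  have hcomp : ∀ t, eps A M (phi A M t) = 0 := by
    intro t
    induction t using TensorProduct.induction_on with
    | zero => simp
    | add a b ha hb => simp only [map_add, ha, hb, add_zero]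
    | tmul p m => rw [phi_tmul, map_sub, eps_tmul, eps_tmul, mul_smul, sub_self]
  intro t
  constructor
  · intro ht
    have : ∀ t : A[X] ⊗[A] M, t - (1 : A[X]) ⊗ₜ[A] (eps A M t) ∈ LinearMap.range (phi A M) := by
      intro t
      induction t using TensorProduct.induction_on with
      | zero => simp
      | add a b ha hb =>
        convert add_mem ha hb using 1
        rw [map_add, tmul_add]; abel
      | tmul p m => rw [eps_tmul]; exact sub_mem p m
    have h := this t
    rw [ht, tmul_zero, sub_zero] at h
    exact h
  · rintro ⟨s, rfl⟩
    exact hcomp s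

lemma pd_lt_two [Module.Projective A M] :
    HasProjectiveDimensionLT (ModuleCat.of A[X] M) 2 := by
  have hsurj : Function.Surjective (eps A M) := fun m => ⟨1 ⊗ₜ m, by simp [eps_tmul]⟩
  let S : ShortComplex (ModuleCat.{0} A[X]) :=
    ShortComplex.mk (ModuleCat.ofHom (phi A M)) (ModuleCat.ofHom (eps A M))
      (ModuleCat.hom_ext (LinearMap.ext fun t => eps_exact.apply_apply_eq_zero t))
  have hp : Projective (ModuleCat.of A[X] (A[X] ⊗[A] M)) :=
    (IsProjective.iff_projective _).1 inferInstance
  have hS : S.ShortExact :=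
    { exact := (ShortComplex.ShortExact.moduleCat_exact_iff_function_exact S).2 eps_exact
      mono_f := (ModuleCat.mono_iff_injective _).2 phi_inj
      epi_g := (ModuleCat.epi_iff_surjective _).2 hsurj }
  exact hS.hasProjectiveDimensionLT_X₃ 1 inferInstance inferInstance
end

lemma short_ker {R : Type} [CommRing R] {F M : Type} [AddCommGroup F] [Module R F]
    [AddCommGroup M] [Module R M] (f : F →ₗ[R] M) (hf : Function.Surjective f)
    [Module.Projective R F] (k : ℕ) :
    HasProjectiveDimensionLT (ModuleCat.of R M) (k + 2) ↔
      HasProjectiveDimensionLT (ModuleCat.of R (LinearMap.ker f)) (k + 1) :=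
  (LinearMap.shortExact_shortComplexKer hf).hasProjectiveDimensionLT_X₃_iff k
    ((IsProjective.iff_projective _).1 inferInstance)

lemma pd_step {A R : Type} [CommRing A] [CommRing R] [Algebra A[X] R] [Algebra A R]
    [IsScalarTower A A[X] R]
    [Module.Free A[X] R] (M : Type) [AddCommGroup M] [Module A M] [Module A[X] M] [Module R M]
    [IsScalarTower A A[X] M] [IsScalarTower A[X] R M] [Module.Projective A M] :
    ∃ (N : Type) (_ : AddCommGroup N) (_ : Module R N) (_ : Module A[X] N)
      (_ : IsScalarTower A[X] R N) (_ : Module.Projective A[X] N),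
      ∀ k, HasProjectiveDimensionLT (ModuleCat.of R N) (k + 1) →
        HasProjectiveDimensionLT (ModuleCat.of R M) (k + 2) := by
  let f : (M →₀ R) →ₗ[R] M := Finsupp.linearCombination R id
  have hf : Function.Surjective f := fun m => ⟨Finsupp.single m 1, by simp [f]⟩
  refine ⟨LinearMap.ker f, inferInstance, inferInstance, inferInstance, inferInstance, ?_, ?_⟩
  · have h1 := pd_lt_two (A := A) (M := M)
    have h2 := (short_ker (f.restrictScalars A[X]) hf 0).1 h1
    rw [zero_add, ← projective_iff_hasProjectiveDimensionLT_one, ← IsProjective.iff_projective] at h2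
    exact h2
  · intro k hk
    exact (short_ker f hf k).2 hk

lemma pd_le (k : ℕ) : ∀ (A R : Type) [CommRing A] [CommRing R] [Algebra A R]
    (_ : MvPolynomial (Fin k) A ≃ₐ[A] R) (M : Type) [AddCommGroup M] [Module A M] [Module R M]
    [IsScalarTower A R M] [Module.Projective A M],
    HasProjectiveDimensionLT (ModuleCat.of R M) (k + 1) := by
  induction k with
  | zero =>
    intro A R _ _ _ e M _ _ _ _ _
    rw [zero_add, ← projective_iff_hasProjectiveDimensionLT_one, ← IsProjective.iff_projective]
    let e' : A ≃ₐ[A] R := (MvPolynomial.isEmptyAlgEquiv A (Fin 0)).symm.trans e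
    have he : ∀ a, e' a = algebraMap A R a := fun a => e'.commutes a
    let := RingHomInvPair.of_ringEquiv e'.toRingEquiv
    let := RingHomInvPair.symm (e'.toRingEquiv : A →+* R) (e'.toRingEquiv.symm : R →+* A)
    refine Module.Projective.of_equiv (R := A) (S := R) (σ := (e'.toRingEquiv : A →+* R))
      (σ' := (e'.toRingEquiv.symm : R →+* A)) (M := M) (N := M) 
      { AddEquiv.refl M with map_smul' := ?_ }
    intro a m
    change a • m = (e' a) • m
    rw [he, algebraMap_smul]
  | succ k ih =>
    intro A R _ _ _ e M _ _ _ _ _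
    let e1 : MvPolynomial (Fin k) A[X] ≃ₐ[A] R :=
      (MvPolynomial.optionEquivRight A (Fin k)).symm.trans
        ((MvPolynomial.renameEquiv A (finSuccEquiv k)).symm.trans e)
    let alg : Algebra A[X] R := (e1.toRingHom.comp MvPolynomial.C).toAlgebra
    let e2 : MvPolynomial (Fin k) A[X] ≃ₐ[A[X]] R :=
      AlgEquiv.ofRingEquiv (f := e1.toRingEquiv) (fun r => rfl)
    let : Module A[X] M := Module.compHom M (algebraMap A[X] R)
    have : IsScalarTower A[X] R M := IsScalarTower.of_algebraMap_smul fun r m => rfl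
    have : IsScalarTower A A[X] R := IsScalarTower.of_algebraMap_eq fun a => by
      change _ = e1 (MvPolynomial.C (Polynomial.C a))
      rw [← e1.commutes]; rfl
    have : IsScalarTower A A[X] M := IsScalarTower.of_algebraMap_smul fun a m => by
      rw [← algebraMap_smul R (algebraMap A A[X] a) m, ← IsScalarTower.algebraMap_apply,
        algebraMap_smul]
    have : Module.Free A[X] R := Module.Free.of_equiv e2.toLinearEquiv
    obtain ⟨N, _, _, _, _, _, hN⟩ := pd_step (A := A) (R := R) M
    exact hN k (ih A[X] R e2 N)

lemma gldim {n : ℕ} {K : Type} [Field K] (M : Type) [AddCommGroup M]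
    [Module (MvPolynomial (Fin n) K) M] :
    HasProjectiveDimensionLT (ModuleCat.of (MvPolynomial (Fin n) K) M) (n + 1) := by
  let : Module K M := Module.compHom M (algebraMap K (MvPolynomial (Fin n) K))
  have : IsScalarTower K (MvPolynomial (Fin n) K) M :=
    IsScalarTower.of_algebraMap_smul fun r m => rfl
  exact pd_le n K _ AlgEquiv.refl M
end Pom

namespace Pom
open CategoryTheory Abelian TensorProduct

section
variable {R : Type} [CommRing R] {M : Type} [AddCommGroup M] [Module R M]

/-- the short complex `M/N → M/N → M/L` given by multiplication with `x`. -/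
noncomputable def ses (N N' : Submodule R M) (x : R) (hle : N ≤ N') (hx : ∀ m, x • m ∈ N') :
    ShortComplex (ModuleCat.{0} R) :=
  ShortComplex.mk (X₁ := ModuleCat.of R (M ⧸ N)) (X₂ := ModuleCat.of R (M ⧸ N))
    (X₃ := ModuleCat.of R (M ⧸ N')) (x • 𝟙 _)
    (ModuleCat.ofHom (Submodule.factor hle))
    (by
      apply ModuleCat.hom_ext
      apply LinearMap.ext
      intro t
      obtain ⟨m, rfl⟩ := Submodule.Quotient.mk_surjective _ t
      exact (Submodule.Quotient.mk_eq_zero N').2 (hx m))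

lemma ses_exact (N N' : Submodule R M) (x : R) (hle : N ≤ N') (hx : ∀ m, x • m ∈ N')
    (hreg : ∀ m, x • m ∈ N → m ∈ N) (hN' : ∀ m ∈ N', ∃ a, m - x • a ∈ N) :
    (ses N N' x hle hx).ShortExact :=
  { exact := by
      refine (ShortComplex.ShortExact.moduleCat_exact_iff_function_exact _).2 ?_
      intro t
      obtain ⟨m, rfl⟩ := Submodule.Quotient.mk_surjective _ t
      constructor
      · intro h
        obtain ⟨a, ha⟩ := hN' m ((Submodule.Quotient.mk_eq_zero N').1 h)
        exact ⟨Submodule.Quotient.mk a, ((Submodule.Quotient.eq N).2 ha).symm⟩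
      · rintro ⟨s, hs⟩
        obtain ⟨a, rfl⟩ := Submodule.Quotient.mk_surjective _ s
        rw [← hs]
        exact (Submodule.Quotient.mk_eq_zero N').2 (hx a)
    mono_f := by
      refine (ModuleCat.mono_iff_injective _).2 ?_
      refine (injective_iff_map_eq_zero _).2 ?_
      intro t h
      obtain ⟨m, rfl⟩ := Submodule.Quotient.mk_surjective _ t
      exact (Submodule.Quotient.mk_eq_zero N).2 (hreg m ((Submodule.Quotient.mk_eq_zero N).1 h))
    epi_g := (ModuleCat.epi_iff_surjective _).2 (Submodule.factor_surjective hle) }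

lemma ext_step (N N' : Submodule R M) (x : R) (hle : N ≤ N') (hx : ∀ m, x • m ∈ N')
    (hreg : ∀ m, x • m ∈ N → m ∈ N) (hN' : ∀ m ∈ N', ∃ a, m - x • a ∈ N)
    (T : ModuleCat.{0} R) (hT : x • 𝟙 T = 0) (k : ℕ)
    (h : Nontrivial (Ext (ModuleCat.of R (M ⧸ N)) T k)) :
    Nontrivial (Ext (ModuleCat.of R (M ⧸ N')) T (k + 1)) := by
  by_contra hn
  rw [not_nontrivial_iff_subsingleton] at hn
  have hS := ses_exact N N' x hle hx hreg hN'
  obtain ⟨e, he⟩ := exists_ne (0 : Ext (ModuleCat.of R (M ⧸ N)) T k)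
  have h0 : hS.extClass.comp (show Ext (ses N N' x hle hx).X₁ T k from e) (add_comm 1 k) = 0 :=
    @Subsingleton.elim _ hn _ _
  obtain ⟨e2, he2⟩ := Ext.contravariant_sequence_exact₁ hS _ _ (add_comm 1 k) h0
  apply he
  have h1 : x • e2 = 0 := by
    have : x • e2 = e2.comp (Ext.mk₀ (x • 𝟙 T)) (add_zero k) := by
      rw [Ext.mk₀_smul, Ext.comp_smul, Ext.comp_mk₀_id]
    rw [this, hT, Ext.mk₀_zero, Ext.comp_zero]
  have h2 : ∀ z : Ext (ModuleCat.of R (M ⧸ N)) T k,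
      (Ext.mk₀ (x • 𝟙 (ModuleCat.of R (M ⧸ N)))).comp z (zero_add k) = x • z := by
    intro z
    rw [Ext.mk₀_smul, Ext.smul_comp, Ext.mk₀_id_comp]
  exact he2.symm.trans ((h2 e2).trans h1)

end

section
variable {n : ℕ} {K : Type} [Field K] (M : Type) [AddCommGroup M]
    [Module (MvPolynomial (Fin n) K) M]

/-- the ideal generated by the first `k` variables -/
noncomputable def varI (n : ℕ) (K : Type) [Field K] (k : ℕ) : Ideal (MvPolynomial (Fin n) K) :=
  Ideal.span (MvPolynomial.X '' {i : Fin n | i.val < k})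

/-- `(x_0,…,x_{k-1}) M` -/
noncomputable def Nk (k : ℕ) : Submodule (MvPolynomial (Fin n) K) M :=
  varI n K k • ⊤

lemma varI_succ (k : Fin n) : varI n K (k.val + 1) =
    varI n K k.val ⊔ Ideal.span {MvPolynomial.X k} := by
  rw [varI, varI, ← Ideal.span_union]
  congr 1
  ext f
  simp only [Set.mem_image, Set.mem_ofPred_eq, Set.mem_union, Set.mem_singleton_iff]
  constructor
  · rintro ⟨i, hi, rfl⟩
    rcases Nat.lt_succ_iff_lt_or_eq.1 hi with h | h
    · exact Or.inl ⟨i, h, rfl⟩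
    · exact Or.inr (by rw [Fin.ext h])
  · rintro (⟨i, hi, rfl⟩ | rfl)
    · exact ⟨i, by omega, rfl⟩
    · exact ⟨k, by omega, rfl⟩

lemma Nk_succ (k : Fin n) (m : M) (hm : m ∈ Nk (n := n) (K := K) M (k.val + 1)) :
    ∃ a : M, m - (MvPolynomial.X k : MvPolynomial (Fin n) K) • a ∈ Nk (n := n) (K := K) M k.val := by
  rw [Nk, varI_succ, Submodule.sup_smul, Submodule.mem_sup] at hm
  obtain ⟨y, hy, z, hz, rfl⟩ := hm
  rw [Submodule.ideal_span_singleton_smul, Submodule.mem_smul_pointwise_iff_exists] at hz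
  obtain ⟨a, -, rfl⟩ := hz
  exact ⟨a, by rw [add_sub_cancel_right]; exact hy⟩

lemma Nk_le (k : ℕ) : Nk (n := n) (K := K) M k ≤ Nk M (k + 1) :=
  Submodule.smul_mono_left (Ideal.span_mono (Set.image_mono fun i (hi : i.val < k) =>
    show i.val < k + 1 by omega))

lemma Nk_smul {k : ℕ} {i : Fin n} (hi : i.val < k) (m : M) :
    (MvPolynomial.X i : MvPolynomial (Fin n) K) • m ∈ Nk (n := n) (K := K) M k :=
  Submodule.smul_mem_smul (Ideal.subset_span ⟨i, hi, rfl⟩) trivial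

lemma Nk_zero : Nk (n := n) (K := K) M 0 = ⊥ := by
  simp [Nk, varI]

lemma pd_quot (t : ℕ) (hM : HasProjectiveDimensionLT (ModuleCat.of (MvPolynomial (Fin n) K) M) t)
    (c : ℕ) (hc : c ≤ n) (hreg : ∀ k : Fin n, k.val < c → ∀ m : M,
      (MvPolynomial.X k : MvPolynomial (Fin n) K) • m ∈ Nk (n := n) (K := K) M k.val →
        m ∈ Nk (n := n) (K := K) M k.val) :
    HasProjectiveDimensionLT (ModuleCat.of (MvPolynomial (Fin n) K)
      (M ⧸ Nk (n := n) (K := K) M c)) (t + c) := by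
  induction c with
  | zero =>
    have e : M ≃ₗ[MvPolynomial (Fin n) K] (M ⧸ Nk (n := n) (K := K) M 0) :=
      (Submodule.quotEquivOfEqBot _ (Nk_zero M)).symm
    exact hasProjectiveDimensionLT_of_iso e.toModuleIso _
  | succ c ih =>
    have h := ih (by omega) (fun k hk => hreg k (by omega))
    have hS := ses_exact (Nk (n := n) (K := K) M c) (Nk (n := n) (K := K) M (c + 1))
      (MvPolynomial.X ⟨c, by omega⟩) (Nk_le M c) (Nk_smul M (show c < c + 1 by omega))
      (hreg ⟨c, by omega⟩ (show c < c + 1 by omega)) (Nk_succ M ⟨c, by omega⟩)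
    exact hS.hasProjectiveDimensionLT_X₃ (t + c) h
      (@hasProjectiveDimensionLT_of_ge _ _ _ _ (t + c) (t + c + 1) (by omega) h)

end

lemma not_pd {n : ℕ} {K : Type} [Field K] :
    ¬ HasProjectiveDimensionLT (ModuleCat.of (MvPolynomial (Fin n) K)
      (MvPolynomial (Fin n) K ⧸ Nk (n := n) (K := K) (MvPolynomial (Fin n) K) n)) n := by
  set P := MvPolynomial (Fin n) K with hP
  set T := ModuleCat.of P (P ⧸ Nk (n := n) (K := K) P n)
  have hmem : ∀ (k : ℕ) (f : P), f ∈ Nk (n := n) (K := K) P k ↔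
      ∀ m ∈ f.support, ∃ i ∈ {i : Fin n | i.val < k}, (m : Fin n →₀ ℕ) i ≠ 0 := by
    intro k f
    rw [← MvPolynomial.mem_ideal_span_X_image, Nk, smul_eq_mul, Ideal.mul_top, varI]
  have hT : ∀ i : Fin n, (MvPolynomial.X i : P) • 𝟙 T = 0 := by
    intro i
    apply ModuleCat.hom_ext
    apply LinearMap.ext
    intro t
    obtain ⟨m, rfl⟩ := Submodule.Quotient.mk_surjective _ t
    exact (Submodule.Quotient.mk_eq_zero _).2 (Nk_smul P i.2 m)
  have key : ∀ k, k ≤ n → Nontrivial (Ext (ModuleCat.of P (P ⧸ Nk (n := n) (K := K) P k)) T k) := by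
    intro k
    induction k with
    | zero =>
      intro _
      have hle : Nk (n := n) (K := K) P 0 ≤ Nk P n := by rw [Nk_zero]; exact bot_le
      let g : ModuleCat.of P (P ⧸ Nk (n := n) (K := K) P 0) ⟶ T :=
        ModuleCat.ofHom (Submodule.factor hle)
      refine ⟨⟨Ext.mk₀ g, 0, ?_⟩⟩
      rw [Ne, Ext.mk₀_eq_zero_iff]
      intro h
      have h1 : g.hom (Submodule.Quotient.mk 1) = 0 := by rw [h]; rfl
      have h2 : (1 : P) ∈ Nk (n := n) (K := K) P n := (Submodule.Quotient.mk_eq_zero _).1 h1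
      rw [hmem] at h2
      obtain ⟨i, _, hi⟩ := h2 0 (by simp)
      exact hi rfl
    | succ k ih =>
      intro hk
      refine ext_step (Nk (n := n) (K := K) P k) (Nk (n := n) (K := K) P (k + 1))
        (MvPolynomial.X ⟨k, by omega⟩) (Nk_le P k) (Nk_smul P (show k < k + 1 by omega))
        ?_ (Nk_succ P ⟨k, by omega⟩) T (hT _) k (ih (by omega))
      intro f hf
      rw [hmem] at hf ⊢
      intro m hm
      obtain ⟨i, hi, h⟩ := hf (Finsupp.single ⟨k, by omega⟩ 1 + m) (by
        rw [smul_eq_mul, MvPolynomial.mem_support_iff, MvPolynomial.coeff_X_mul]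
        exact MvPolynomial.mem_support_iff.1 hm)
      refine ⟨i, hi, ?_⟩
      have hne : (⟨k, by omega⟩ : Fin n) ≠ i := by
        rintro rfl
        exact lt_irrefl _ (show k < k from hi)
      simpa [Finsupp.single_apply, hne] using h
  intro h
  have := key n le_rfl
  exact (not_subsingleton_iff_nontrivial.2 this) (HasProjectiveDimensionLT.subsingleton _ n n le_rfl T)
end Pom

namespace Pom

variable {n : ℕ} {K : Type} [Field K]

lemma cls_spec {μ : Fin n →₀ ℕ} (h : μ ≠ 0) :
    ∃ hi : cls μ < n, μ ⟨cls μ, hi⟩ ≠ 0 := by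
  have : {i : ℕ | ∃ hi : i < n, μ ⟨i, hi⟩ ≠ 0}.Nonempty := by
    obtain ⟨j, hj⟩ := Finsupp.ne_iff.1 h
    exact ⟨j.val, j.2, hj⟩
  exact Nat.sInf_mem this

lemma cls_le {μ : Fin n →₀ ℕ} {i : Fin n} (h : μ i ≠ 0) : cls μ ≤ i.val :=
  Nat.sInf_le ⟨i.2, h⟩

/-- The data needed for the core argument. -/
structure Core (m : MonomialOrder (Fin n)) (J : Ideal (MvPolynomial (Fin n) K))
    (E : Set (Fin n →₀ ℕ)) (p : (Fin n →₀ ℕ) → MvPolynomial (Fin n) K) (d0 : ℕ) : Prop where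
  rev : IsRevLex m
  fin : E.Finite
  div : ∀ f ∈ J, f ≠ 0 → ∃! μ, μ ∈ E ∧ InvDiv μ (m.degree f)
  mem : ∀ μ ∈ E, p μ ∈ J
  ne : ∀ μ ∈ E, p μ ≠ 0
  deg : ∀ μ ∈ E, m.degree (p μ) = μ
  hom : ∀ μ ∈ E, (p μ).IsHomogeneous (Finsupp.degree μ)
  nz : ∀ μ ∈ E, μ ≠ 0
  le : ∀ μ ∈ E, d0 ≤ cls μ
  ex : ∃ μ ∈ E, cls μ = d0

/-- The set of leading exponents. -/
def SS (m : MonomialOrder (Fin n)) (J : Ideal (MvPolynomial (Fin n) K)) : Set (Fin n →₀ ℕ) :=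
  {ν | ∃ f ∈ J, f ≠ 0 ∧ m.degree f = ν}

lemma degree_mono_mul (m : MonomialOrder (Fin n)) (α : Fin n →₀ ℕ) {f : MvPolynomial (Fin n) K}
    (hf : f ≠ 0) : m.degree (monomial α 1 * f) = α + m.degree f := by
  classical
  rw [m.degree_mul (by simp) hf, m.degree_monomial]
  simp

lemma SS_add {m : MonomialOrder (Fin n)} {J : Ideal (MvPolynomial (Fin n) K)} {ν : Fin n →₀ ℕ}
    (h : ν ∈ SS m J) (α : Fin n →₀ ℕ) : α + ν ∈ SS m J := by
  obtain ⟨f, hf, h0, rfl⟩ := h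
  exact ⟨monomial α 1 * f, J.mul_mem_left _ hf, mul_ne_zero (by simp) h0, degree_mono_mul m α h0⟩

lemma SS_le {m : MonomialOrder (Fin n)} {J : Ideal (MvPolynomial (Fin n) K)} {μ ν : Fin n →₀ ℕ}
    (h : μ ∈ SS m J) (hle : μ ≤ ν) : ν ∈ SS m J := by
  rw [← tsub_add_cancel_of_le hle]
  exact SS_add h _

section
variable {m : MonomialOrder (Fin n)} {J : Ideal (MvPolynomial (Fin n) K)}
  {E : Set (Fin n →₀ ℕ)} {p : (Fin n →₀ ℕ) → MvPolynomial (Fin n) K} {d0 : ℕ}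

lemma Core.div' (c : Core m J E p d0) (ν : SS m J) : ∃! μ, μ ∈ E ∧ InvDiv μ ν.1 := by
  obtain ⟨ν, f, hf, h0, rfl⟩ := ν
  exact c.div f hf h0

/-- The involutive divisor -/
noncomputable def Core.rho (c : Core m J E p d0) (ν : SS m J) : Fin n →₀ ℕ := (c.div' ν).choose

lemma Core.rho_mem (c : Core m J E p d0) (ν : SS m J) : c.rho ν ∈ E := (c.div' ν).choose_spec.1.1

lemma Core.rho_div (c : Core m J E p d0) (ν : SS m J) : InvDiv (c.rho ν) ν.1 :=
  (c.div' ν).choose_spec.1.2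

lemma Core.rho_eq (c : Core m J E p d0) (ν : SS m J) (μ : Fin n →₀ ℕ) (h : μ ∈ E)
    (h' : InvDiv μ ν.1) : c.rho ν = μ :=
  ((c.div' ν).choose_spec.2 μ ⟨h, h'⟩).symm

lemma Core.E_mem (c : Core m J E p d0) {μ : Fin n →₀ ℕ} (h : μ ∈ E) : μ ∈ SS m J :=
  ⟨p μ, c.mem μ h, c.ne μ h, c.deg μ h⟩

lemma Core.rho_self (c : Core m J E p d0) {μ : Fin n →₀ ℕ} (h : μ ∈ E) :
    c.rho ⟨μ, c.E_mem h⟩ = μ :=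
  c.rho_eq _ _ h ⟨le_rfl, fun _ hj => absurd rfl hj⟩

lemma Core.rho_add (c : Core m J E p d0) (ν : SS m J) (α : Fin n →₀ ℕ)
    (hα : ∀ i, α i ≠ 0 → i.val ≤ d0) : c.rho ⟨α + ν.1, SS_add ν.2 α⟩ = c.rho ν := by
  apply c.rho_eq _ _ (c.rho_mem ν)
  refine ⟨(c.rho_div ν).1.trans (le_add_of_nonneg_left zero_le), ?_⟩
  intro j hj
  by_cases h : α j = 0
  · refine (c.rho_div ν).2 j ?_
    simpa [h] using hj
  · exact (hα j h).trans (c.le _ (c.rho_mem ν))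

/-- the basis elements -/
noncomputable def Core.b (c : Core m J E p d0) (ν : SS m J) : MvPolynomial (Fin n) K :=
  monomial (ν.1 - c.rho ν) 1 * p (c.rho ν)

lemma Core.b_mem (c : Core m J E p d0) (ν : SS m J) : c.b ν ∈ J :=
  J.mul_mem_left _ (c.mem _ (c.rho_mem ν))

lemma Core.b_ne (c : Core m J E p d0) (ν : SS m J) : c.b ν ≠ 0 :=
  mul_ne_zero (by simp) (c.ne _ (c.rho_mem ν))

lemma Core.b_deg (c : Core m J E p d0) (ν : SS m J) : m.degree (c.b ν) = ν.1 := by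
  rw [Core.b, degree_mono_mul m _ (c.ne _ (c.rho_mem ν)), c.deg _ (c.rho_mem ν),
    tsub_add_cancel_of_le (c.rho_div ν).1]

lemma Core.b_hom (c : Core m J E p d0) (ν : SS m J) :
    (c.b ν).IsHomogeneous (Finsupp.degree ν.1) := by
  have h1 : (monomial (ν.1 - c.rho ν) (1 : K)).IsHomogeneous (Finsupp.degree (ν.1 - c.rho ν)) :=
    isHomogeneous_monomial _ rfl
  have := h1.mul (c.hom _ (c.rho_mem ν))
  rwa [← map_add, tsub_add_cancel_of_le (c.rho_div ν).1] at this

lemma Core.b_add (c : Core m J E p d0) (ν : SS m J) (α : Fin n →₀ ℕ)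
    (hα : ∀ i, α i ≠ 0 → i.val ≤ d0) :
    c.b ⟨α + ν.1, SS_add ν.2 α⟩ = monomial α 1 * c.b ν := by
  rw [Core.b, Core.b, c.rho_add ν α hα, ← mul_assoc, monomial_mul, one_mul,
    add_tsub_assoc_of_le (c.rho_div ν).1]

lemma reduce (m : MonomialOrder (Fin n)) {f g : MvPolynomial (Fin n) K} (hg : g ≠ 0)
    (h : m.degree f = m.degree g) :
    ∃ a : K, f - C a * g = 0 ∨ m.toSyn (m.degree (f - C a * g)) < m.toSyn (m.degree f) := by
  refine ⟨f.coeff (m.degree f) / g.coeff (m.degree g), ?_⟩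
  set a := f.coeff (m.degree f) / g.coeff (m.degree g) with ha
  by_cases h0 : f - C a * g = 0
  · exact Or.inl h0
  right
  have hle : m.toSyn (m.degree (f - C a * g)) ≤ m.toSyn (m.degree f) := by
    refine m.degree_sub_le.trans (sup_le le_rfl ?_)
    rw [h, C_mul']
    exact m.degree_smul_le
  refine lt_of_le_of_ne hle ?_
  intro heq
  have heq' := m.toSyn.injective heq
  have := m.degree_mem_support h0
  rw [heq', mem_support_iff, coeff_sub, coeff_C_mul, ha, h] at this
  have hg' : g.coeff (m.degree g) ≠ 0 := m.coeff_degree_ne_zero_iff.2 hg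
  apply this
  field_simp
  simp

/-- as elements of `J` -/
noncomputable def Core.bJ (c : Core m J E p d0) (ν : SS m J) : J := ⟨c.b ν, c.b_mem ν⟩

lemma Core.span (c : Core m J E p d0) : ⊤ ≤ Submodule.span K (Set.range c.bJ) := by
  have key : ∀ (s : m.syn) (f : J), m.toSyn (m.degree f.1) = s →
      f ∈ Submodule.span K (Set.range c.bJ) := by
    intro s
    induction s using WellFoundedLT.induction with
    | _ s ih =>
      rintro ⟨f, hf⟩ rfl
      by_cases h0 : f = 0
      · subst h0
        exact zero_mem _
      let ν : SS m J := ⟨m.degree f, f, hf, h0, rfl⟩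
      obtain ⟨a, ha⟩ := reduce m (c.b_ne ν) (f := f) (c.b_deg ν).symm
      have hm : (⟨f - C a * c.b ν, J.sub_mem hf (J.mul_mem_left _ (c.b_mem ν))⟩ : J) ∈
          Submodule.span K (Set.range c.bJ) := by
        rcases ha with ha | ha
        · have h3 : (⟨f - C a * c.b ν, J.sub_mem hf (J.mul_mem_left _ (c.b_mem ν))⟩ : J) = 0 :=
            Subtype.ext ha
          rw [h3]
          exact Submodule.zero_mem _
        · exact ih _ ha _ rfl
      have h2 : a • c.bJ ν ∈ Submodule.span K (Set.range c.bJ) :=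
        Submodule.smul_mem _ _ (Submodule.subset_span ⟨ν, rfl⟩)
      convert add_mem hm h2 using 1
      apply Subtype.ext
      simp [Core.bJ, C_mul']
  intro f _
  exact key _ f rfl

lemma Core.li (c : Core m J E p d0) : LinearIndependent K c.bJ := by
  have h1 : LinearIndependent K c.b := by
    rw [linearIndependent_iff]
    intro l hl
    by_contra hne
    obtain ⟨ν, hν, hmax⟩ := l.support.exists_max_image (fun ν => m.toSyn ν.1)
      (Finsupp.support_nonempty_iff.2 hne)
    have := congrArg (coeff ν.1) hl
    rw [Finsupp.linearCombination_apply, Finsupp.sum, coeff_sum, coeff_zero,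
      Finset.sum_eq_single ν] at this
    · rw [coeff_smul, smul_eq_mul, mul_eq_zero] at this
      rcases this with h | h
      · exact Finsupp.mem_support_iff.1 hν h
      · have h2 := m.coeff_degree_ne_zero_iff.2 (c.b_ne ν)
        rw [c.b_deg] at h2
        exact h2 h
    · intro ν' hν' hn
      rw [coeff_smul, m.coeff_eq_zero_of_lt, smul_zero]
      rw [c.b_deg]
      refine lt_of_le_of_ne (hmax ν' hν') fun h => hn (Subtype.ext (m.toSyn.injective h))
    · intro h
      exact absurd hν h
  exact LinearIndependent.of_comp (J.subtype.restrictScalars K) h1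

/-- the basis -/
noncomputable def Core.bas (c : Core m J E p d0) : Module.Basis (SS m J) K J :=
  Module.Basis.mk c.li c.span

lemma Core.bas_apply (c : Core m J E p d0) (ν : SS m J) : c.bas ν = c.bJ ν := by
  simp [Core.bas]

lemma Core.mono_bas (c : Core m J E p d0) (ν : SS m J) (α : Fin n →₀ ℕ)
    (hα : ∀ i, α i ≠ 0 → i.val ≤ d0) :
    (monomial α (1 : K)) • c.bas ν = c.bas ⟨α + ν.1, SS_add ν.2 α⟩ := by
  rw [c.bas_apply, c.bas_apply]
  exact Subtype.ext (c.b_add ν α hα).symm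

end
end Pom

namespace Pom
open CategoryTheory
variable {n : ℕ} {K : Type} [Field K]

/-- the variables of index at most `d0` -/
abbrev Lo (n d0 : ℕ) := {i : Fin n // i.val ≤ d0}

/-- the splitting of the variables -/
noncomputable def eqv (n d0 : ℕ) : Fin (n - 1 - d0) ⊕ Lo n d0 ≃ Fin n :=
  (Equiv.sumCongr (Fintype.equivOfCardEq (by
    rw [Fintype.card_fin, Fintype.card_subtype_compl, Fintype.card_fin]
    have : Fintype.card (Lo n d0) = min n (d0 + 1) := by
      rw [Fintype.card_subtype]
      have h := Fin.card_filter_val_lt (n := n) (m := d0 + 1)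
      simpa [Nat.lt_succ_iff] using h
    rw [this]
    omega)) (Equiv.refl _)).trans
  ((Equiv.sumComm _ _).trans (Equiv.sumCompl (fun i : Fin n => i.val ≤ d0)))

lemma eqv_inr (n d0 : ℕ) (i : Lo n d0) : eqv n d0 (Sum.inr i) = i.1 := rfl

/-- the splitting of the polynomial ring -/
noncomputable def spl (n d0 : ℕ) (K : Type) [Field K] :
    MvPolynomial (Fin (n - 1 - d0)) (MvPolynomial (Lo n d0) K) ≃ₐ[K] MvPolynomial (Fin n) K :=
  (sumAlgEquiv K _ _).symm.trans (renameEquiv K (eqv n d0))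

lemma spl_C (n d0 : ℕ) (q : MvPolynomial (Lo n d0) K) :
    spl n d0 K (C q) = rename Subtype.val q := by
  induction q using MvPolynomial.induction_on with
  | C a =>
    rw [rename_C]
    exact (spl n d0 K).commutes a
  | add p q hp hq => simp only [map_add, hp, hq]
  | mul_X p i hp =>
    rw [map_mul, map_mul, map_mul, hp, rename_X]
    congr 1
    have : (sumAlgEquiv K (Fin (n - 1 - d0)) (Lo n d0)).symm (C (X i)) = X (Sum.inr i) := by
      rw [AlgEquiv.symm_apply_eq]
      simp
    rw [spl, AlgEquiv.trans_apply, this, renameEquiv_apply, rename_X, eqv_inr]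

variable {m : MonomialOrder (Fin n)} {J : Ideal (MvPolynomial (Fin n) K)}
  {E : Set (Fin n →₀ ℕ)} {p : (Fin n →₀ ℕ) → MvPolynomial (Fin n) K} {d0 : ℕ}

/-- primitive exponents -/
def Core.Prim (c : Core m J E p d0) : Type := {ν : SS m J // ∀ i : Fin n, i.val ≤ d0 → ν.1 i = c.rho ν i}

/-- extension by zero of an exponent vector -/
noncomputable def up (α : Lo n d0 →₀ ℕ) : Fin n →₀ ℕ := α.mapDomain Subtype.val

lemma up_val (α : Lo n d0 →₀ ℕ) (i : Lo n d0) : up α i.1 = α i :=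
  Finsupp.mapDomain_apply Subtype.val_injective _ _

lemma up_ne (α : Lo n d0 →₀ ℕ) (i : Fin n) (h : up α i ≠ 0) : i.val ≤ d0 := by
  by_contra hi
  apply h
  apply Finsupp.mapDomain_of_notMem_range
  rintro ⟨j, rfl⟩
  exact hi j.2

lemma Core.prim_bij (c : Core m J E p d0) : Function.Bijective
    (fun x : (Σ _ : c.Prim, (Lo n d0 →₀ ℕ)) =>
      (⟨up x.2 + x.1.1.1, SS_add x.1.1.2 _⟩ : SS m J)) := by
  constructor
  · rintro ⟨⟨ν, hν⟩, α⟩ ⟨⟨ν', hν'⟩, α'⟩ h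
    have h1 : up α + ν.1 = up α' + ν'.1 := congrArg Subtype.val h
    have h2 : c.rho ν = c.rho ν' := by
      rw [← c.rho_add ν (up α) (up_ne α), ← c.rho_add ν' (up α') (up_ne α')]
      exact congrArg c.rho h
    have h3 : α = α' := by
      ext i
      have h4 := DFunLike.congr_fun h1 i.1
      simp only [Finsupp.add_apply, up_val] at h4
      rw [hν i.1 i.2, hν' i.1 i.2, h2] at h4
      omega
    subst h3
    have h5 : ν = ν' := Subtype.ext (add_left_cancel h1)
    subst h5
    rfl
  · intro ν
    let α : Lo n d0 →₀ ℕ := Finsupp.equivFunOnFinite.symm fun i => ν.1 i.1 - c.rho ν i.1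
    have hα : ∀ i : Fin n, i.val ≤ d0 → up α i = ν.1 i - c.rho ν i := fun i hi => up_val α ⟨i, hi⟩
    have hα' : ∀ i : Fin n, ¬ i.val ≤ d0 → up α i = 0 := fun i hi => by
      by_contra h
      exact hi (up_ne α i h)
    have hle := (c.rho_div ν).1
    have hup : up α ≤ ν.1 := by
      intro i
      by_cases hi : i.val ≤ d0
      · rw [hα i hi]; omega
      · rw [hα' i hi]; omega
    have hge : c.rho ν ≤ ν.1 - up α := by
      intro i
      have := hle i
      rw [Finsupp.tsub_apply]
      by_cases hi : i.val ≤ d0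
      · rw [hα i hi]; omega
      · rw [hα' i hi]; omega
    let ν0 : SS m J := ⟨ν.1 - up α, SS_le (c.E_mem (c.rho_mem ν)) hge⟩
    have hν0 : (⟨up α + ν0.1, SS_add ν0.2 _⟩ : SS m J) = ν :=
      Subtype.ext (add_tsub_cancel_of_le hup)
    have hr : c.rho ν0 = c.rho ν := by
      rw [← c.rho_add ν0 (up α) (up_ne α), hν0]
    refine ⟨⟨⟨ν0, ?_⟩, α⟩, hν0⟩
    intro i hi
    rw [hr]
    have := hle i
    change (ν.1 - up α) i = _
    rw [Finsupp.tsub_apply, hα i hi]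
    omega

lemma Core.upper (c : Core m J E p d0) :
    HasProjectiveDimensionLT (ModuleCat.of (MvPolynomial (Fin n) K) J) (n - 1 - d0 + 1) := by
  let A := MvPolynomial (Lo n d0) K
  let P := MvPolynomial (Fin n) K
  let alg : Algebra A P := ((spl n d0 K).toRingHom.comp C).toAlgebra
  let e : MvPolynomial (Fin (n - 1 - d0)) A ≃ₐ[A] P :=
    AlgEquiv.ofRingEquiv (f := (spl n d0 K).toRingEquiv) (fun r => rfl)
  have halg : ∀ a : A, algebraMap A P a = rename Subtype.val a := spl_C n d0
  have tow : IsScalarTower K A P := IsScalarTower.of_algebraMap_eq fun a => by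
    rw [halg]; simp [A, P, MvPolynomial.algebraMap_eq]
  have towJ : IsScalarTower K A J := inferInstance
  let Φ : (c.Prim →₀ A) →ₗ[A] J := Finsupp.linearCombination A (fun ν : c.Prim => c.bas ν.1)
  let B : Module.Basis (Σ _ : c.Prim, (Lo n d0 →₀ ℕ)) K (c.Prim →₀ A) :=
    Finsupp.basis fun _ => basisMonomials (Lo n d0) K
  let ε := Equiv.ofBijective _ c.prim_bij
  let Ψ : (c.Prim →₀ A) ≃ₗ[K] J := B.equiv c.bas ε
  have hΦ : Φ.restrictScalars K = Ψ.toLinearMap := by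
    apply B.ext
    rintro ⟨ν, α⟩
    have h1 : B ⟨ν, α⟩ = Finsupp.single ν (monomial α 1) := by
      simp only [B, Finsupp.coe_basis]
      exact congrArg (Finsupp.single ν) (congrFun (coe_basisMonomials _ _) α)
    change Φ (B ⟨ν, α⟩) = Ψ (B ⟨ν, α⟩)
    rw [Module.Basis.equiv_apply, h1, Finsupp.linearCombination_single]
    have h2 : ε ⟨ν, α⟩ = ⟨up α + ν.1.1, SS_add ν.1.2 _⟩ := rfl
    rw [h2, ← c.mono_bas ν.1 (up α) (up_ne α), ← algebraMap_smul P, halg, rename_monomial]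
    rfl
  have hbij : Function.Bijective Φ := by
    have : ⇑Φ = ⇑Ψ := funext fun x => LinearMap.congr_fun hΦ x
    rw [this]
    exact Ψ.bijective
  have : Module.Free A J := Module.Free.of_equiv (LinearEquiv.ofBijective Φ hbij)
  exact pd_le (n - 1 - d0) A P e J

end Pom

namespace Pom
open CategoryTheory
variable {n : ℕ} {K : Type} [Field K]
variable {m : MonomialOrder (Fin n)} {J : Ideal (MvPolynomial (Fin n) K)}
  {E : Set (Fin n →₀ ℕ)} {p : (Fin n →₀ ℕ) → MvPolynomial (Fin n) K} {d0 : ℕ}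

/-- exponent of a variable -/
noncomputable abbrev ee (i : Fin n) : Fin n →₀ ℕ := Finsupp.single i 1

/-- leading exponents that are variable multiples -/
def TT (m : MonomialOrder (Fin n)) (J : Ideal (MvPolynomial (Fin n) K)) (k : ℕ) : Set (SS m J) :=
  {ν | ∃ i : Fin n, i.val < k ∧ ∃ ν' : SS m J, ν = ⟨ee i + ν'.1, SS_add ν'.2 _⟩}

lemma ee_ne {i j : Fin n} (h : ee i j ≠ 0) : j = i := by
  by_contra hne
  exact h (Finsupp.single_eq_of_ne hne)

lemma Core.X_bas (c : Core m J E p d0) (ν : SS m J) (i : Fin n) (hi : i.val ≤ d0) :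
    (X i : MvPolynomial (Fin n) K) • c.bas ν = c.bas ⟨ee i + ν.1, SS_add ν.2 _⟩ :=
  c.mono_bas ν (ee i) fun j hj => by rw [ee_ne hj]; exact hi

lemma Core.rho_ee (c : Core m J E p d0) (ν : SS m J) (i : Fin n) (hi : i.val ≤ d0) :
    c.rho ⟨ee i + ν.1, SS_add ν.2 _⟩ = c.rho ν :=
  c.rho_add ν (ee i) fun j hj => by rw [ee_ne hj]; exact hi

lemma Core.X_repr (c : Core m J E p d0) (f : J) (i : Fin n) (hi : i.val ≤ d0) :
    c.bas.repr ((X i : MvPolynomial (Fin n) K) • f) =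
      (c.bas.repr f).mapDomain (fun ν => ⟨ee i + ν.1, SS_add ν.2 _⟩) := by
  let L : J →ₗ[K] J :=
    { toFun := fun f => (X i : MvPolynomial (Fin n) K) • f
      map_add' := smul_add _
      map_smul' := fun a f => smul_comm _ _ _ }
  have : c.bas.repr.toLinearMap ∘ₗ L = (Finsupp.lmapDomain K K
      (fun ν : SS m J => (⟨ee i + ν.1, SS_add ν.2 _⟩ : SS m J))) ∘ₗ c.bas.repr.toLinearMap := by
    apply c.bas.ext
    intro ν
    change c.bas.repr ((X i : MvPolynomial (Fin n) K) • c.bas ν) =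
      (c.bas.repr (c.bas ν)).mapDomain _
    rw [c.X_bas ν i hi, Module.Basis.repr_self, Module.Basis.repr_self, Finsupp.mapDomain_single]
  exact LinearMap.congr_fun this f

lemma Core.mem_Nk (c : Core m J E p d0) (k : ℕ) (hk : k ≤ d0 + 1) (f : J) :
    f ∈ Nk (n := n) (K := K) J k ↔ f ∈ Submodule.span K (c.bas '' TT m J k) := by
  constructor
  · intro hf
    refine Submodule.smul_induction_on hf ?_ (fun x y hx hy => add_mem hx hy)
    intro r hr f hf0
    clear hf0
    revert f
    refine Submodule.span_induction ?_ ?_ ?_ ?_ hr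
    · rintro _ ⟨i, hi, rfl⟩ f
      have hi' : i.val < k := hi
      rw [Module.Basis.mem_span_image, c.X_repr f i (by omega)]
      intro ν hν
      classical
      have := Finsupp.mapDomain_support hν
      obtain ⟨ν', _, rfl⟩ := Finset.mem_image.1 this
      exact ⟨i, hi', ν', rfl⟩
    · intro f
      rw [zero_smul]
      exact Submodule.zero_mem _
    · intro x y _ _ hx hy f
      rw [add_smul]
      exact add_mem (hx f) (hy f)
    · intro a x _ hx f
      rw [smul_eq_mul, mul_comm, mul_smul]
      exact hx _
  · intro hf
    have : Submodule.span K (c.bas '' TT m J k) ≤ (Nk (n := n) (K := K) J k).restrictScalars K := by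
      rw [Submodule.span_le]
      rintro _ ⟨_, ⟨i, hi, ν', rfl⟩, rfl⟩
      change _ ∈ Nk (n := n) (K := K) J k
      rw [← c.X_bas ν' i (by omega)]
      exact Nk_smul J hi _
    exact this hf

lemma Core.reg (c : Core m J E p d0) (k : Fin n) (hk : k.val < d0 + 1) (f : J)
    (hf : (X k : MvPolynomial (Fin n) K) • f ∈ Nk (n := n) (K := K) J k.val) :
    f ∈ Nk (n := n) (K := K) J k.val := by
  rw [c.mem_Nk _ (by omega), Module.Basis.mem_span_image] at hf ⊢
  intro ν hν
  have hinj : Function.Injective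
      (fun ν : SS m J => (⟨ee k + ν.1, SS_add ν.2 _⟩ : SS m J)) := fun a b h =>
    Subtype.ext (add_left_cancel (congrArg Subtype.val h))
  have h1 : (⟨ee k + ν.1, SS_add ν.2 _⟩ : SS m J) ∈
      (c.bas.repr ((X k : MvPolynomial (Fin n) K) • f)).support := by
    rw [c.X_repr f k (by omega), Finsupp.mem_support_iff]
    have := Finsupp.mapDomain_apply hinj (c.bas.repr f) ν
    rw [this]
    exact Finsupp.mem_support_iff.1 hν
  obtain ⟨i, hi, ν', hν'⟩ := hf h1
  have h2 : c.rho ν = c.rho ν' := by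
    rw [← c.rho_ee ν k (by omega), hν', c.rho_ee ν' i (by omega)]
  have h3 : ee k + ν.1 = ee i + ν'.1 := congrArg Subtype.val hν'
  have hne : i ≠ k := by
    rintro rfl
    omega
  have h5 := (c.rho_div ν').1
  have h6 := (c.rho_div ν).1
  have hik : ee k i = 0 := Finsupp.single_eq_of_ne hne
  have hii : ee i i = 1 := Finsupp.single_eq_same
  have h7 := DFunLike.congr_fun h3 i
  rw [Finsupp.add_apply, Finsupp.add_apply, hik, hii] at h7
  have hle : ee i ≤ ν.1 := by
    rw [Finsupp.single_le_iff]
    omega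
  refine ⟨i, hi, ⟨ν.1 - ee i, SS_le (c.E_mem (c.rho_mem ν)) ?_⟩, Subtype.ext ?_⟩
  · intro j
    rw [Finsupp.tsub_apply]
    by_cases hj : j = i
    · subst hj
      have := h5 j
      rw [← h2] at this
      omega
    · have : ee i j = 0 := Finsupp.single_eq_of_ne hj
      have := h6 j
      omega
  · exact (add_tsub_cancel_of_le hle).symm

lemma Core.prim_case (c : Core m J E p d0) (q : ℕ)
    (hq : ∀ μ ∈ E, cls μ = d0 → Finsupp.degree μ ≤ q) (ν : SS m J)
    (hν : q < Finsupp.degree ν.1) (i : Fin n) (hi : i.val ≤ d0) (hi0 : ν.1 i ≠ 0) :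
    ν ∈ TT m J (d0 + 1) := by
  have hle := (c.rho_div ν).1
  by_cases h : ∃ j : Fin n, j.val ≤ d0 ∧ c.rho ν j < ν.1 j
  · obtain ⟨j, hj, hlt⟩ := h
    have hle1 : ee j ≤ ν.1 := by
      rw [Finsupp.single_le_iff]
      omega
    refine ⟨j, by omega, ⟨ν.1 - ee j, SS_le (c.E_mem (c.rho_mem ν)) ?_⟩, Subtype.ext ?_⟩
    · intro l
      rw [Finsupp.tsub_apply]
      by_cases hl : l = j
      · subst hl
        have : ee l l = 1 := Finsupp.single_eq_same
        omega
      · have : ee j l = 0 := Finsupp.single_eq_of_ne hl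
        have := hle l
        omega
    · exact (add_tsub_cancel_of_le hle1).symm
  · push Not at h
    exfalso
    have heq : ∀ j : Fin n, j.val ≤ d0 → ν.1 j = c.rho ν j := fun j hj =>
      le_antisymm (h j hj) (hle j)
    have hc : cls (c.rho ν) = d0 := by
      refine le_antisymm ?_ (c.le _ (c.rho_mem ν))
      exact (cls_le (by rw [← heq i hi]; exact hi0)).trans hi
    have : ν.1 = c.rho ν := by
      ext j
      by_contra hj
      have := (c.rho_div ν).2 j hj
      rw [hc] at this
      exact hj (heq j this)
    have h2 := hq _ (c.rho_mem ν) hc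
    rw [this] at hν
    omega

lemma hom_degree {f : MvPolynomial (Fin n) K} {q : ℕ} (hf : f.IsHomogeneous q) (h0 : f ≠ 0) :
    Finsupp.degree (m.degree f) = q := by
  have := hf (m.coeff_degree_ne_zero_iff.2 h0)
  rw [Finsupp.degree_eq_weight_one]
  exact this

lemma sum_eq_degree (μ : Fin n →₀ ℕ) : (μ.sum fun _ e => e) = Finsupp.degree μ := rfl

lemma Core.claim (c : Core m J E p d0) (q : ℕ)
    (hq : ∀ μ ∈ E, cls μ = d0 → Finsupp.degree μ ≤ q) (q' : ℕ) (hq' : q < q') :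
    ∀ (s : m.syn) (f : J), m.toSyn (m.degree f.1) = s → f.1.IsHomogeneous q' →
      (∃ i : Fin n, i.val ≤ d0 ∧ m.degree f.1 i ≠ 0) →
      f ∈ Nk (n := n) (K := K) J (d0 + 1) := by
  intro s
  induction s using WellFoundedLT.induction with
  | _ s ih =>
    rintro ⟨f, hf⟩ rfl hhom ⟨i, hi, hi0⟩
    by_cases h0 : f = 0
    · subst h0
      exact zero_mem _
    have hdeg : Finsupp.degree (m.degree f) = q' := hom_degree hhom h0
    let ν : SS m J := ⟨m.degree f, f, hf, h0, rfl⟩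
    obtain ⟨a, ha⟩ := reduce m (c.b_ne ν) (f := f) (c.b_deg ν).symm
    have hbN : c.bJ ν ∈ Nk (n := n) (K := K) J (d0 + 1) := by
      rw [c.mem_Nk _ le_rfl, ← c.bas_apply]
      exact Submodule.subset_span ⟨ν, c.prim_case q hq ν (by
        change q < Finsupp.degree (m.degree f); omega) i hi hi0, rfl⟩
    have hghom : (f - C a * c.b ν).IsHomogeneous q' := by
      have hb := c.b_hom ν
      have : Finsupp.degree ν.1 = q' := hdeg
      rw [this] at hb
      exact hhom.sub (hb.C_mul a)
    have hm : (⟨f - C a * c.b ν, J.sub_mem hf (J.mul_mem_left _ (c.b_mem ν))⟩ : J) ∈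
        Nk (n := n) (K := K) J (d0 + 1) := by
      by_cases hz : f - C a * c.b ν = 0
      · have h3 : (⟨f - C a * c.b ν, J.sub_mem hf (J.mul_mem_left _ (c.b_mem ν))⟩ : J) = 0 :=
          Subtype.ext hz
        rw [h3]
        exact Submodule.zero_mem _
      · have ha := ha.resolve_left hz
        refine ih _ ha _ rfl hghom ?_
        change ∃ i : Fin n, i.val ≤ d0 ∧ m.degree (f - C a * c.b ν) i ≠ 0
        have hd2 : Finsupp.degree (m.degree (f - C a * c.b ν)) = q' := hom_degree hghom hz
        rcases (c.rev _ _).1 ha with h | ⟨_, l, hl, hl'⟩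
        · rw [sum_eq_degree, sum_eq_degree] at h
          omega
        · rcases lt_or_ge i l with hil | hil
          · exact ⟨i, hi, by rw [hl' i hil]; exact hi0⟩
          · have : l.val ≤ i.val := hil
            exact ⟨l, by omega, by omega⟩
    convert add_mem hm (Submodule.smul_mem _ (C a) hbN) using 1
    apply Subtype.ext
    simp [Core.bJ]

lemma Core.socle (c : Core m J E p d0) : ∃ h : J, h ∉ Nk (n := n) (K := K) J (d0 + 1) ∧
    ∀ j : Fin n, (X j : MvPolynomial (Fin n) K) • h ∈ Nk (n := n) (K := K) J (d0 + 1) := by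
  have hfin : {μ | μ ∈ E ∧ cls μ = d0}.Finite := c.fin.subset fun μ h => h.1
  obtain ⟨μ0, h0, h0'⟩ := c.ex
  obtain ⟨μ, ⟨hμ, hc⟩, hmax⟩ := hfin.exists_maximalFor Finsupp.degree _ ⟨μ0, h0, h0'⟩
  have hq : ∀ μ' ∈ E, cls μ' = d0 → Finsupp.degree μ' ≤ Finsupp.degree μ := by
    intro μ' h1 h2
    rcases le_total (Finsupp.degree μ') (Finsupp.degree μ) with h | h
    · exact h
    · exact hmax ⟨h1, h2⟩ h
  let ν : SS m J := ⟨μ, c.E_mem hμ⟩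
  have hρ : c.rho ν = μ := c.rho_self hμ
  refine ⟨c.bas ν, ?_, ?_⟩
  · rw [c.mem_Nk _ le_rfl, Module.Basis.mem_span_image, Module.Basis.repr_self]
    intro h
    obtain ⟨i, hi, ν', hν'⟩ := h (show ν ∈ (Finsupp.single ν (1 : K)).support by simp)
    have h1 : c.rho ν' = μ := by rw [← hρ, hν', c.rho_ee ν' i (by omega)]
    have h2 := (c.rho_div ν').1 i
    rw [h1] at h2
    have h3 := DFunLike.congr_fun (congrArg Subtype.val hν') i
    have hii : ee i i = 1 := Finsupp.single_eq_same
    change μ i = (ee i + ν'.1) i at h3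
    rw [Finsupp.add_apply, hii] at h3
    omega
  · intro j
    rw [c.bas_apply]
    obtain ⟨hcn, hcne⟩ := cls_spec (c.nz μ hμ)
    have hb := c.b_hom ν
    have hX : (X j : MvPolynomial (Fin n) K) = monomial (ee j) 1 := rfl
    have hdeg : m.degree (X j * c.b ν) = ee j + μ := by
      rw [hX, degree_mono_mul m _ (c.b_ne ν), c.b_deg]
    refine c.claim (Finsupp.degree μ) hq (1 + Finsupp.degree μ) (by omega) _ _ rfl ?_ ?_
    · exact (isHomogeneous_X K j).mul hb
    · refine ⟨⟨cls μ, hcn⟩, hc.le, ?_⟩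
      change m.degree (X j * c.b ν) _ ≠ 0
      rw [hdeg, Finsupp.add_apply]
      omega

lemma Core.lower (c : Core m J E p d0) (hd : d0 < n) :
    ¬ HasProjectiveDimensionLT (ModuleCat.of (MvPolynomial (Fin n) K) J) (n - 1 - d0) := by
  intro hJ
  let P := MvPolynomial (Fin n) K
  have hM := pd_quot (n := n) (K := K) J _ hJ (d0 + 1) (by omega) c.reg
  have hn : n - 1 - d0 + (d0 + 1) = n := by omega
  rw [hn] at hM
  obtain ⟨h, hh, hX⟩ := c.socle
  let Q := J ⧸ Nk (n := n) (K := K) J (d0 + 1)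
  let φ : P →ₗ[P] Q := LinearMap.toSpanSingleton P Q (Submodule.Quotient.mk h)
  have hφ : ∀ r : P, φ r = Submodule.Quotient.mk (r • h) := fun r => rfl
  have hker : Nk (n := n) (K := K) P n ≤ LinearMap.ker φ := by
    rw [Nk, smul_eq_mul, Ideal.mul_top, varI, Ideal.span_le]
    rintro _ ⟨j, -, rfl⟩
    change φ (X j) = 0
    rw [hφ]
    exact (Submodule.Quotient.mk_eq_zero _).2 (hX j)
  have hker' : LinearMap.ker φ ≤ Nk (n := n) (K := K) P n := by
    intro r hr
    have hr' : φ r = 0 := hr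
    have hg : r - C (coeff 0 r) ∈ Nk (n := n) (K := K) P n := by
      rw [Nk, smul_eq_mul, Ideal.mul_top, varI, mem_ideal_span_X_image]
      intro μ hμ
      have hne : μ ≠ 0 := by
        rintro rfl
        rw [mem_support_iff] at hμ
        exact hμ (by erw [coeff_sub, coeff_zero_C, sub_self])
      obtain ⟨j, hj⟩ := Finsupp.ne_iff.1 hne
      exact ⟨j, j.2, hj⟩
    have h1 : φ (C (coeff 0 r)) = 0 := by
      have h2 : φ (r - C (coeff 0 r)) = 0 := hker hg
      rw [map_sub, hr', zero_sub, neg_eq_zero] at h2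
      exact h2
    by_cases hz : coeff 0 r = 0
    · rw [hz, C_0, sub_zero] at hg
      exact hg
    · exfalso
      apply hh
      rw [hφ, Submodule.Quotient.mk_eq_zero] at h1
      have h3 := Submodule.smul_mem _ (C (coeff 0 r)⁻¹ : P) h1
      rwa [smul_smul, ← C_mul, inv_mul_cancel₀ hz, C_1, one_smul] at h3
  let ψ : (P ⧸ Nk (n := n) (K := K) P n) →ₗ[P] Q := (Nk (n := n) (K := K) P n).liftQ φ hker
  have hinj : Function.Injective ψ := by
    rw [← LinearMap.ker_eq_bot]
    exact Submodule.ker_liftQ_eq_bot _ _ _ hker'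
  let S : ShortComplex (ModuleCat.{0} P) := ShortComplex.mk (ModuleCat.ofHom ψ)
    (ModuleCat.ofHom (LinearMap.range ψ).mkQ)
    (ModuleCat.hom_ext (LinearMap.range_mkQ_comp ψ))
  have hS : S.ShortExact :=
    { exact := (ShortComplex.ShortExact.moduleCat_exact_iff_function_exact S).2
        (LinearMap.exact_map_mkQ_range ψ)
      mono_f := (ModuleCat.mono_iff_injective _).2 hinj
      epi_g := (ModuleCat.epi_iff_surjective _).2 (Submodule.mkQ_surjective _) }
  exact not_pd (hS.hasProjectiveDimensionLT_X₁ n hM (gldim (n := n) (K := K) _))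

lemma Core.projDim_eq (c : Core m J E p d0) :
    projDim (ModuleCat.of (MvPolynomial (Fin n) K) J) = n - 1 - d0 := by
  have hd : d0 < n := by
    obtain ⟨μ, h, rfl⟩ := c.ex
    exact (cls_spec (c.nz μ h)).1
  exact Pom.projDim_eq _ _ c.upper fun _ => c.lower hd

end Pom

namespace Pom
variable {n : ℕ} {K : Type} [Field K]
variable {m : MonomialOrder (Fin n)} {I : Ideal (MvPolynomial (Fin n) K)}

lemma homComp_mem (hI : IsHomIdeal I) {f : MvPolynomial (Fin n) K} (hf : f ∈ I) (q : ℕ) :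
    homogeneousComponent q f ∈ I := by
  obtain ⟨S, hS, rfl⟩ := hI
  letI : GradedAlgebra (homogeneousSubmodule (Fin n) K) := MvPolynomial.gradedAlgebra
  have h1 := Ideal.homogeneous_span (homogeneousSubmodule (Fin n) K) S
    (fun x hx => (hS x hx).imp fun d hd => hd)
  have h2 := h1 q hf
  rw [← MvPolynomial.decomposition.decompose'_apply]
  exact h2

lemma degree_homComp {f : MvPolynomial (Fin n) K} (hf : f ≠ 0) :
    homogeneousComponent (Finsupp.degree (m.degree f)) f ≠ 0 ∧
    m.degree (homogeneousComponent (Finsupp.degree (m.degree f)) f) = m.degree f := by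
  have hc : coeff (m.degree f) (homogeneousComponent (Finsupp.degree (m.degree f)) f) ≠ 0 := by
    rw [coeff_homogeneousComponent, if_pos rfl]
    exact m.coeff_degree_ne_zero_iff.2 hf
  refine ⟨fun h => hc (by rw [h, coeff_zero]), ?_⟩
  apply m.toSyn.injective
  apply le_antisymm
  · rw [m.degree_le_iff]
    intro b hb
    apply m.le_degree
    rw [mem_support_iff, coeff_homogeneousComponent] at hb
    rw [mem_support_iff]
    intro h0
    apply hb
    rw [h0, ite_self]
  · exact m.le_degree (mem_support_iff.2 hc)

end Pom

/-- Thm. 4.4 (i): in δ-regular variables for revlex,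
`pd I = pd (lt I) = n - d` where `d` is the minimal class of the Pommaret basis
(1-based `d = d₀ + 1`, so `n - d = n - 1 - d₀`). -/
theorem statement16 {n : ℕ} {K : Type} [Field K] (m : MonomialOrder (Fin n))
    (hrev : IsRevLex m)
    (I : Ideal (MvPolynomial (Fin n) K)) (hI0 : I ≠ ⊥) (hIT : I ≠ ⊤) (hIhom : IsHomIdeal I)
    (H : Finset (MvPolynomial (Fin n) K)) (hPB : IsPB m H I)
    (d0 : ℕ) (hd0 : IsLeast {c : ℕ | ∃ h ∈ H, cls (ldeg m h) = c} d0) :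
    projDim (ModuleCat.of (MvPolynomial (Fin n) K) I) =
      projDim (ModuleCat.of (MvPolynomial (Fin n) K) (ltIdeal m I)) ∧
    projDim (ModuleCat.of (MvPolynomial (Fin n) K) I) = n - 1 - d0 := by
  classical
  obtain ⟨hHI, hH0, hinj, hfin, hspan, hdiv⟩ := hPB
  have hld : ∀ f : MvPolynomial (Fin n) K, ldeg m f = m.degree f := fun _ => rfl
  set E : Set (Fin n →₀ ℕ) := (fun h : MvPolynomial (Fin n) K => ldeg m h) '' ↑H with hE
  have hch : ∀ μ : Fin n →₀ ℕ, ∃ h : MvPolynomial (Fin n) K, μ ∈ E → h ∈ H ∧ m.degree h = μ := by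
    intro μ
    by_cases hμ : μ ∈ E
    · obtain ⟨h, hh, rfl⟩ := hμ
      exact ⟨h, fun _ => ⟨hh, rfl⟩⟩
    · exact ⟨0, fun h => absurd h hμ⟩
  choose g hg using hch
  have hnz : ∀ μ ∈ E, μ ≠ 0 := by
    rintro _ hμ rfl
    obtain ⟨h1, h2⟩ := hg 0 hμ
    have h3 := m.eq_C_of_degree_eq_zero h2
    have h4 : m.leadingCoeff (g 0) ≠ 0 := m.leadingCoeff_ne_zero_iff.2 (hH0 _ h1)
    apply hIT
    refine Ideal.eq_top_of_isUnit_mem I (hHI _ h1) ?_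
    rw [h3]
    exact (isUnit_iff_ne_zero.2 h4).map C
  have hle : ∀ μ ∈ E, d0 ≤ cls μ := by
    rintro _ ⟨h, hh, rfl⟩
    exact hd0.2 ⟨h, hh, rfl⟩
  have hex : ∃ μ ∈ E, cls μ = d0 := by
    obtain ⟨h, hh, hc⟩ := hd0.1
    exact ⟨_, ⟨h, hh, rfl⟩, hc⟩
  have c1 : Pom.Core m I E (fun μ => homogeneousComponent (Finsupp.degree μ) (g μ)) d0 :=
    { rev := hrev
      fin := hfin
      div := fun f hf h0 => hdiv _ (Ideal.subset_span ⟨f, hf, h0, rfl⟩)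
      mem := fun μ hμ => Pom.homComp_mem hIhom (hHI _ (hg μ hμ).1) _
      ne := fun μ hμ => by
        have := (Pom.degree_homComp (m := m) (hH0 _ (hg μ hμ).1)).1
        rwa [(hg μ hμ).2] at this
      deg := fun μ hμ => by
        have := (Pom.degree_homComp (m := m) (hH0 _ (hg μ hμ).1)).2
        rwa [(hg μ hμ).2] at this
      hom := fun μ hμ => homogeneousComponent_isHomogeneous _ _
      nz := hnz
      le := hle
      ex := hex }
  have c2 : Pom.Core m (ltIdeal m I) E (fun μ => monomial μ (1 : K)) d0 :=
    { rev := hrev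
      fin := hfin
      div := fun f hf h0 => by
        apply hdiv
        rw [hspan, mem_ideal_span_monomial_image] at hf ⊢
        have hs : m.degree f ∈ f.support := mem_support_iff.2 (m.coeff_degree_ne_zero_iff.2 h0)
        intro ν hν
        have hν' := support_monomial_subset hν
        rw [Finset.mem_singleton.1 hν']
        exact hf _ hs
      mem := fun μ hμ => by
        rw [hspan]
        exact Ideal.subset_span ⟨μ, hμ, rfl⟩
      ne := fun μ hμ => by simp
      deg := fun μ hμ => by
        change m.degree (monomial μ (1 : K)) = μ
        rw [m.degree_monomial, if_neg one_ne_zero]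
      hom := fun μ hμ => isHomogeneous_monomial _ rfl
      nz := hnz
      le := hle
      ex := hex }
  exact ⟨c1.projDim_eq.trans c2.projDim_eq.symm, c1.projDim_eq⟩
end

section
/- Let H = {h_1,…,h_r} be a Pommaret basis of the quasi-stable monomial ideal I of P, and assume the generators are inversely P-ordered. Then I possesses linear quotients with respect to this ordering; more precisely, for every 1 ≤ k ≤ r one has ⟨h_1,…,h_{k−1}⟩ : h_k = ⟨x_j : cls(h_k) < j ≤ n⟩, the ideal generated by the non-multiplicative variables of h_k. -/
open MvPolynomial

/-- `I` is a monomial ideal. -/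
def IsMonIdeal {n : ℕ} {K : Type*} [Field K] (I : Ideal (MvPolynomial (Fin n) K)) : Prop :=
  ∃ S : Set (Fin n →₀ ℕ), I = Ideal.span ((fun μ => monomial μ (1 : K)) '' S)

/-- A monomial ideal is quasi-stable if it possesses a finite Pommaret basis. -/
def QuasiStable {n : ℕ} {K : Type*} [Field K] (I : Ideal (MvPolynomial (Fin n) K)) : Prop :=
  ∃ H : Set (Fin n →₀ ℕ), IsMonPB H I

/-- Prop. 6.2, first part: an inversely P-ordered Pommaret basis
`h_1, …, h_r` of a quasi-stable monomial ideal yields linear quotients: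
`⟨h_1,…,h_{k-1}⟩ : h_k = ⟨non-multiplicative variables of h_k⟩`. -/
theorem statement17 {n : ℕ} {K : Type*} [Field K]
    (I : Ideal (MvPolynomial (Fin n) K)) (hI0 : I ≠ ⊥) (hIT : I ≠ ⊤)
    (r : ℕ) (h : Fin r → (Fin n →₀ ℕ)) (hinj : Function.Injective h)
    (hPB : IsMonPB (Set.range h) I)
    (hord : ∀ α β : Fin r,
      Relation.TransGen (fun μ ν : Fin n →₀ ℕ =>
        μ ∈ Set.range h ∧ ν ∈ Set.range h ∧
        ∃ j : Fin n, cls μ < (j : ℕ) ∧ InvDiv ν (μ + Finsupp.single j 1)) (h α) (h β) →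
      β < α) :
    ∀ k : Fin r, ∀ f : MvPolynomial (Fin n) K,
      monomial (h k) (1 : K) * f ∈
          Ideal.span {p | ∃ i : Fin r, i < k ∧ p = monomial (h i) (1 : K)} ↔
        f ∈ Ideal.span {p | ∃ j : Fin n, cls (h k) < (j : ℕ) ∧ p = X j} := by
  obtain ⟨-, hspan, huniq⟩ := hPB
  -- every multiple of some `h i` lies in `I`
  have hmem : ∀ (i : Fin r) (ν : Fin n →₀ ℕ), h i ≤ ν → monomial ν (1 : K) ∈ I := by
    intro i ν hi
    rw [hspan, mem_ideal_span_monomial_image]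
    intro xi hxi
    have := support_monomial_subset hxi
    rw [Finset.mem_singleton] at this
    exact ⟨h i, ⟨i, rfl⟩, this ▸ hi⟩
  -- edges of the P-graph
  have hedge : ∀ (i : Fin r) (j : Fin n), cls (h i) < (j : ℕ) →
      ∃ i', i' < i ∧ h i' ≤ h i + Finsupp.single j 1 := by
    intro i j hj
    obtain ⟨μ, ⟨⟨i', rfl⟩, hd⟩, -⟩ := huniq _ (hmem i (h i + Finsupp.single j 1) le_self_add)
    exact ⟨i', hord i i' (Relation.TransGen.single ⟨⟨i, rfl⟩, ⟨i', rfl⟩, j, hj, hd⟩), hd.1⟩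
  -- the involutive divisor has the smallest index among all divisors
  have hmin : ∀ (k : Fin r) (ν : Fin n →₀ ℕ), InvDiv (h k) ν →
      ∀ i : Fin r, h i ≤ ν → k ≤ i := by
    intro k ν hk i
    induction i using WellFoundedLT.induction with
    | ind i ih =>
      intro hi
      by_cases hdiv : InvDiv (h i) ν
      · have := (huniq ν (hmem k ν hk.1)).unique ⟨⟨i, rfl⟩, hdiv⟩ ⟨⟨k, rfl⟩, hk⟩
        exact (hinj this).ge
      · have : ∃ j : Fin n, ν j ≠ h i j ∧ cls (h i) < (j : ℕ) := by
          by_contra hcon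
          push Not at hcon
          exact hdiv ⟨hi, hcon⟩
        obtain ⟨j, hne, hj⟩ := this
        obtain ⟨i', hlt, hle⟩ := hedge i j hj
        refine (ih i' hlt (hle.trans ?_)).trans hlt.le
        intro l
        have hl := hi l
        by_cases hlj : j = l
        · subst hlj
          simp only [Finsupp.add_apply, Finsupp.single_eq_same]
          omega
        · simpa [Finsupp.single_apply, hlj] using hl
  intro k f
  have e1 : {p : MvPolynomial (Fin n) K | ∃ i : Fin r, i < k ∧ p = monomial (h i) (1 : K)} =
      (fun s => monomial s (1 : K)) '' (h '' {i | i < k}) := by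
    ext p
    simp [eq_comm]
  have e2 : {p : MvPolynomial (Fin n) K | ∃ j : Fin n, cls (h k) < (j : ℕ) ∧ p = X j} =
      X '' {j : Fin n | cls (h k) < (j : ℕ)} := by
    ext p
    simp [eq_comm]
  rw [e1, e2, mem_ideal_span_monomial_image, mem_ideal_span_X_image]
  constructor
  · intro H m hm
    have hs : h k + m ∈ (monomial (h k) (1 : K) * f).support := by
      rw [mem_support_iff, coeff_monomial_mul, one_mul]
      exact mem_support_iff.mp hm
    obtain ⟨_, ⟨i, hik, rfl⟩, hle⟩ := H _ hs
    by_contra hcon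
    push Not at hcon
    refine absurd (hmin k (h k + m) ⟨le_self_add, fun j hj => ?_⟩ i hle) (not_le.mpr hik)
    by_contra hlt
    have := hcon j (not_le.mp hlt)
    simp [this] at hj
  · intro H ν hν
    rw [mem_support_iff, coeff_monomial_mul'] at hν
    split_ifs at hν with hle
    · rw [one_mul] at hν
      obtain ⟨j, hj, hne⟩ := H _ (mem_support_iff.mpr hν)
      obtain ⟨i', hlt, hle'⟩ := hedge k j hj
      refine ⟨_, ⟨i', hlt, rfl⟩, hle'.trans ?_⟩
      intro l
      have hl := hle l
      by_cases hlj : j = l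
      · subst hlj
        simp only [Finsupp.tsub_apply] at hne
        simp only [Finsupp.add_apply, Finsupp.single_eq_same]
        omega
      · simpa [Finsupp.single_apply, hlj] using hl
    · exact absurd rfl hν
end

section
/- Let H = {h_1,…,h_r} be a set of monomials generating the monomial ideal I of P such that for every 1 ≤ k ≤ r the colon ideal satisfies ⟨h_1,…,h_{k−1}⟩ : h_k = ⟨x_j : cls(h_k) < j ≤ n⟩ (the ideal generated by the non-multiplicative variables of h_k; for k = 1 the left-hand side is the zero ideal). Then I is quasi-stable and H is its Pommaret basis. -/
open MvPolynomial

/-- Prop. 6.2, converse part: if a monomial generating set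
`h_1, …, h_r` of `I` satisfies `⟨h_1,…,h_{k-1}⟩ : h_k = ⟨non-multiplicative variables
of h_k⟩` for all `k`, then `I` is quasi-stable with Pommaret basis `{h_1,…,h_r}`. -/
theorem statement18 {n : ℕ} {K : Type*} [Field K]
    (I : Ideal (MvPolynomial (Fin n) K))
    (r : ℕ) (h : Fin r → (Fin n →₀ ℕ))
    (hgen : I = Ideal.span ((fun μ => monomial μ (1 : K)) '' Set.range h))
    (hcolon : ∀ k : Fin r, ∀ f : MvPolynomial (Fin n) K,
      monomial (h k) (1 : K) * f ∈
          Ideal.span {p | ∃ i : Fin r, i < k ∧ p = monomial (h i) (1 : K)} ↔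
        f ∈ Ideal.span {p | ∃ j : Fin n, cls (h k) < (j : ℕ) ∧ p = X j}) :
    QuasiStable I ∧ IsMonPB (Set.range h) I := by
  classical
  have key : ∀ (S : Set (Fin n →₀ ℕ)) (ν : Fin n →₀ ℕ),
      monomial ν (1 : K) ∈ Ideal.span ((fun μ => monomial μ (1 : K)) '' S) ↔
        ∃ μ ∈ S, μ ≤ ν := by
    intro S ν
    rw [mem_ideal_span_monomial_image]
    simp [support_monomial]
  have e1 : ∀ k : Fin r, {p | ∃ i : Fin r, i < k ∧ p = monomial (h i) (1 : K)} =
      (fun μ => monomial μ (1 : K)) '' (h '' {i | i < k}) := by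
    intro k
    ext p
    simp [eq_comm]
  have e2 : ∀ c : ℕ, {p : MvPolynomial (Fin n) K | ∃ j : Fin n, c < (j : ℕ) ∧ p = X j} =
      X '' {j : Fin n | c < (j : ℕ)} := by
    intro c
    ext p
    simp [eq_comm]
  have main : ∀ (k : Fin r) (ν : Fin n →₀ ℕ), h k ≤ ν →
      ((∃ i, i < k ∧ h i ≤ ν) ↔ ∃ j : Fin n, cls (h k) < (j : ℕ) ∧ ν j ≠ h k j) := by
    intro k ν hk
    have := hcolon k (monomial (ν - h k) 1)
    rw [monomial_mul, one_mul, add_tsub_cancel_of_le hk, e1, e2, key,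
      mem_ideal_span_X_image] at this
    have h3 : (∃ i, i < k ∧ h i ≤ ν) ↔ ∃ μ ∈ h '' {i | i < k}, μ ≤ ν := by simp
    rw [h3, this]
    simp only [support_monomial, one_ne_zero, if_false, Finset.mem_singleton, forall_eq,
      Set.mem_ofPred_eq, Finsupp.tsub_apply]
    refine exists_congr fun j => and_congr_right fun _ => ?_
    have := hk j
    omega
  have pb : IsMonPB (Set.range h) I := by
    refine ⟨Set.finite_range h, hgen, fun ν hν => ?_⟩
    rw [hgen, key] at hν
    have hne : ∃ k, h k ≤ ν := by simpa using hν
    obtain ⟨k, hk, hmin⟩ : ∃ k, h k ≤ ν ∧ ∀ i, i < k → ¬ h i ≤ ν := by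
      obtain ⟨k, hk, hm⟩ := WellFounded.has_min (wellFounded_lt (α := Fin r)) {k | h k ≤ ν} hne
      exact ⟨k, hk, fun i hi hh => hm i hh hi⟩
    refine ⟨h k, ⟨⟨k, rfl⟩, hk, fun j hj => ?_⟩, ?_⟩
    · by_contra hc
      obtain ⟨i, hi, hle⟩ := (main k ν hk).2 ⟨j, not_le.1 hc, hj⟩
      exact hmin i hi hle
    · rintro _ ⟨⟨l, rfl⟩, hl, hlm⟩
      rcases lt_trichotomy k l with hkl | hkl | hkl
      · obtain ⟨j, hj, hne⟩ := (main l ν hl).1 ⟨k, hkl, hk⟩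
        exact absurd (hlm j hne) (not_le.2 hj)
      · rw [hkl]
      · exact absurd hl (hmin l hkl)
  exact ⟨⟨_, pb⟩, pb⟩
end
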